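/- arXiv:1608.04838 — 3 statements merged into one kernel-verified Lean document; each statement's English description precedes it below -/
import Mathlib

section
/- For any constant c > 0 there exists n_0 such that: if H is a k-partite k-graph with classes of size n ≥ n_0 and minimum legal co-degree δ_{k-1}(H) ≥ cn, then H contains a matching M' with |M'| ≤ (32/c³)(k+2)·log n such that for every j ∈ [k] and every (k+1)-set S of type j, at least 4(k+2)·log n edges of M' are S-absorbing. -/
open Finset in
theorem greedy_aux {ι α : Type*} [DecidableEq α] (I : Finset ι) (hI : I.Nonempty)
    (E : Finset (Finset α)) (k m : ℕ) (hk : 0 < k) (hE : ∀ e ∈ E, e.card = k)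
    (A : ι → Finset α → Prop) [∀ s e, Decidable (A s e)] (N δ : ℝ) (hN : 0 < N) (hδ : 0 < δ)
    (hEN : (E.card : ℝ) ≤ N)
    (h : ∀ U : Finset α, U.card ≤ k * m → ∀ s ∈ I,
      δ * N ≤ ((E.filter (fun e => Disjoint e U ∧ A s e)).card : ℝ)) :
    ∀ m' ≤ m, ∃ M ⊆ E, (∀ a ∈ M, ∀ b ∈ M, a ≠ b → Disjoint a b) ∧ M.card = m' ∧
      ∑ s ∈ I, (1/2 : ℝ) ^ (M.filter (fun e => A s e)).card ≤ I.card * (1 - δ/2) ^ m' := by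
  have hδ1 : δ ≤ 1 := by
    obtain ⟨s, hs⟩ := hI
    have h1 := h ∅ (by simp) s hs
    have h2 : ((E.filter (fun e => Disjoint e ∅ ∧ A s e)).card : ℝ) ≤ E.card := by
      exact_mod_cast card_filter_le _ _
    by_contra hcon
    push Not at hcon
    nlinarith
  intro m'
  induction m' with
  | zero => intro _; exact ⟨∅, by simp⟩
  | succ t ih =>
    intro ht
    obtain ⟨M, hME, hMd, hMc, hMs⟩ := ih (by omega)
    set U := M.biUnion id with hU
    have hUc : U.card ≤ k * m := by
      calc U.card ≤ M.card * k := card_biUnion_le_card_mul _ _ _ (fun a ha => (hE a (hME ha)).le)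
        _ ≤ k * m := by rw [hMc, mul_comm]; exact Nat.mul_le_mul_left _ (by omega)
    set w : ι → ℝ := fun s => (1/2 : ℝ) ^ (M.filter (fun e => A s e)).card with hw
    have hw0 : ∀ s, 0 < w s := fun s => by positivity
    set E' := E.filter (fun e => Disjoint e U) with hE'
    have hsum : ∑ e ∈ E', δ * ∑ s ∈ I, w s ≤ ∑ e ∈ E', ∑ s ∈ I, (if A s e then w s else 0) := by
      rw [sum_comm, sum_const, nsmul_eq_mul]
      have h1 : ((E'.card : ℝ)) ≤ N := le_trans (by exact_mod_cast card_filter_le _ _) hEN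
      have h2 : 0 ≤ ∑ s ∈ I, w s := sum_nonneg fun s _ => (hw0 s).le
      calc (E'.card : ℝ) * (δ * ∑ s ∈ I, w s) ≤ N * (δ * ∑ s ∈ I, w s) := by gcongr
        _ = ∑ s ∈ I, (δ * N) * w s := by rw [← mul_sum]; ring
        _ ≤ _ := by
          apply sum_le_sum
          intro s hs
          rw [← sum_filter, sum_const, nsmul_eq_mul, hE', filter_filter]
          exact mul_le_mul_of_nonneg_right (h U hUc s hs) (hw0 s).le
    have hne : E'.Nonempty := by
      obtain ⟨s, hs⟩ := hI
      have h1 := h U hUc s hs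
      have h2 : 0 < (E.filter (fun e => Disjoint e U ∧ A s e)).card := by
        have : (0:ℝ) < ((E.filter (fun e => Disjoint e U ∧ A s e)).card : ℝ) :=
          lt_of_lt_of_le (by positivity) h1
        exact_mod_cast this
      obtain ⟨e, he⟩ := card_pos.mp h2
      simp only [mem_filter] at he
      exact ⟨e, by simp [hE', he.1, he.2.1]⟩
    obtain ⟨e, he, hle⟩ := exists_le_of_sum_le hne hsum
    simp only [hE', mem_filter] at he
    have hdis : ∀ a ∈ M, Disjoint e a := fun a ha =>
      he.2.mono_right (by rw [hU]; exact subset_biUnion_of_mem id ha)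
    have heM : e ∉ M := by
      intro hm
      have := hdis e hm
      rw [disjoint_self_iff_empty] at this
      have h3 := hE e he.1
      rw [this] at h3; simp at h3; omega
    refine ⟨insert e M, insert_subset he.1 hME, ?_, by rw [card_insert_of_notMem heM, hMc], ?_⟩
    · intro a ha b hb hab
      rcases mem_insert.mp ha with rfl | ha2
      · rcases mem_insert.mp hb with rfl | hb2
        · exact absurd rfl hab
        · exact hdis b hb2
      · rcases mem_insert.mp hb with rfl | hb2
        · exact (hdis a ha2).symm
        · exact hMd a ha2 b hb2 hab
    · have h1 : ∀ s ∈ I, (1/2 : ℝ) ^ ((insert e M).filter (fun e => A s e)).card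
          = w s - 1/2 * (if A s e then w s else 0) := by
        intro s _
        rw [filter_insert]
        split_ifs with hA
        · rw [card_insert_of_notMem (by simp [heM]), pow_succ]
          simp only [hw]; ring
        · simp only [hw]; ring
      rw [sum_congr rfl h1, sum_sub_distrib, ← mul_sum, pow_succ]
      have h2 : ∑ s ∈ I, w s ≤ I.card * (1 - δ/2) ^ t := hMs
      have h3 := mul_le_mul_of_nonneg_right h2 (show 0 ≤ 1 - δ/2 by linarith)
      linarith

section
open Finset Function

theorem slice_eq {k n : ℕ} {α : Type} [DecidableEq α] (P : Fin k → Finset α)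
    (hP : ∀ i, (P i).card = n) (i : Fin k) (R : (Fin k → α) → Prop) [DecidablePred R] :
    n * ((Fintype.piFinset P).filter R).card =
      ∑ f ∈ Fintype.piFinset P, ((P i).filter (fun x => R (update f i x))).card := by
  classical
  rw [mul_comm, ← hP i, ← card_product, ← card_sigma]
  apply card_bij' (fun (p : (Fin k → α) × α) _ => (⟨update p.1 i p.2, p.1 i⟩ : (_ : Fin k → α) × α))
    (fun q _ => (update q.1 i q.2, q.1 i))
  · rintro ⟨f, x⟩ h
    simp only [mem_product, mem_filter, Fintype.mem_piFinset, mem_sigma] at h ⊢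
    refine ⟨fun a => ?_, h.1.1 i, ?_⟩
    · by_cases ha : a = i
      · subst ha; simpa using h.2
      · simpa [ha] using h.1.1 a
    · simpa using h.1.2
  · rintro ⟨f, x⟩ h
    simp only [mem_product, mem_filter, Fintype.mem_piFinset, mem_sigma] at h ⊢
    refine ⟨⟨fun a => ?_, h.2.2⟩, h.1 i⟩
    by_cases ha : a = i
    · subst ha; simpa using h.2.1
    · simpa [ha] using h.1 a
  · rintro ⟨f, x⟩ h; simp
  · rintro ⟨f, x⟩ h; simp

theorem slice_le {k n : ℕ} (hn : 0 < n) {α : Type} [DecidableEq α] (P : Fin k → Finset α)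
    (hP : ∀ i, (P i).card = n) (i : Fin k) (c : ℝ) (Q R : (Fin k → α) → Prop)
    [DecidablePred Q] [DecidablePred R] (hQ : ∀ f x, Q (update f i x) ↔ Q f)
    (hR : ∀ f ∈ Fintype.piFinset P, c * n ≤ (((P i).filter (fun x => R (update f i x))).card : ℝ)) :
    c * ((Fintype.piFinset P).filter Q).card ≤
      (((Fintype.piFinset P).filter (fun f => Q f ∧ R f)).card : ℝ) := by
  have h1 := slice_eq P hP i (fun f => Q f ∧ R f)
  have h1' : (n : ℝ) * ((Fintype.piFinset P).filter (fun f => Q f ∧ R f)).card =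
      ∑ f ∈ Fintype.piFinset P, (((P i).filter
        (fun x => Q (update f i x) ∧ R (update f i x))).card : ℝ) := by exact_mod_cast h1
  have h2 : (n : ℝ) * (c * ((Fintype.piFinset P).filter Q).card) ≤
      ∑ f ∈ Fintype.piFinset P, (((P i).filter
        (fun x => Q (update f i x) ∧ R (update f i x))).card : ℝ) := by
    calc (n : ℝ) * (c * ((Fintype.piFinset P).filter Q).card)
        = ∑ f ∈ (Fintype.piFinset P).filter Q, c * n := by
          rw [sum_const, nsmul_eq_mul]; ring
      _ = ∑ f ∈ (Fintype.piFinset P), if Q f then c * n else 0 := by rw [sum_filter]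
      _ ≤ _ := by
        apply sum_le_sum
        intro f hf
        split_ifs with hq
        · simpa [hQ, hq] using hR f hf
        · positivity
  rw [← h1'] at h2
  exact le_of_mul_le_mul_left h2 (by exact_mod_cast hn)

theorem bad_le {k n : ℕ} {α : Type} [DecidableEq α] (P : Fin k → Finset α)
    (hP : ∀ i, (P i).card = n) (U : Finset α) :
    n * ((Fintype.piFinset P).filter (fun f => ∃ i, f i ∈ U)).card ≤ k * U.card * n ^ k := by
  have h1 : ((Fintype.piFinset P).filter (fun f => ∃ i, f i ∈ U)) ⊆
      univ.biUnion (fun i : Fin k => (Fintype.piFinset P).filter (fun f => f i ∈ U)) := by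
    intro f
    simp only [mem_filter, mem_biUnion, mem_univ, true_and]
    rintro ⟨a, i, b⟩
    exact ⟨i, a, b⟩
  have hT : (Fintype.piFinset P).card = n ^ k := by
    rw [Fintype.card_piFinset]; simp [hP]
  calc _ ≤ n * ∑ i : Fin k, ((Fintype.piFinset P).filter (fun f => f i ∈ U)).card :=
        Nat.mul_le_mul_left _ ((card_le_card h1).trans card_biUnion_le)
    _ = ∑ i : Fin k, n * ((Fintype.piFinset P).filter (fun f => f i ∈ U)).card := by rw [mul_sum]
    _ ≤ ∑ i : Fin k, n ^ k * U.card := by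
        apply sum_le_sum
        intro i _
        rw [slice_eq P hP i, ← hT, ← smul_eq_mul]
        apply sum_le_card_nsmul
        intro f _
        apply card_le_card
        intro x
        simp
    _ = _ := by simp; ring

theorem count_trans {k n : ℕ} (hk : 3 ≤ k) (hn : 0 < n) {α : Type} [DecidableEq α]
    (P : Fin k → Finset α)
    (hP : ∀ i, (P i).card = n) (c : ℝ) (hc : 0 < c) (F : (Fin k → α) → Prop) [DecidablePred F]
    (hF : ∀ f ∈ Fintype.piFinset P, ∀ i,
      c * n ≤ (((P i).filter (fun x => F (update f i x))).card : ℝ))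
    (g : Fin k → α) (hg : g ∈ Fintype.piFinset P) (j r : Fin k) (hrj : r ≠ j)
    (v : α) (hv : v ∈ P j) (U : Finset α) (hU : (k * U.card : ℝ) ≤ c ^ 3 / 2 * n) :
    c ^ 3 / 2 * n ^ k ≤ (((Fintype.piFinset P).filter (fun f => F f ∧ (∀ i, f i ∉ U) ∧
      F (update g r (f r)) ∧ F (update (update f j v) r (g r)))).card : ℝ) := by
  have hT : (Fintype.piFinset P).card = n ^ k := by
    rw [Fintype.card_piFinset]; simp [hP]
  obtain ⟨q, hqj, hqr⟩ : ∃ q : Fin k, q ≠ j ∧ q ≠ r := by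
    have : ∃ q ∈ (univ : Finset (Fin k)), q ∉ ({j, r} : Finset (Fin k)) := by
      apply exists_mem_notMem_of_card_lt_card
      have := card_le_two (a := j) (b := r)
      simp; omega
    obtain ⟨q, _, hq⟩ := this
    exact ⟨q, by simp at hq; tauto⟩
  have hup : ∀ f ∈ Fintype.piFinset P, ∀ i, ∀ x ∈ P i, update f i x ∈ Fintype.piFinset P := by
    intro f hf i x hx
    rw [Fintype.mem_piFinset] at hf ⊢
    intro a
    by_cases ha : a = i
    · subst ha; simpa using hx
    · simpa [ha] using hf a
  have s1 := slice_le hn P hP r c (fun _ => True) (fun f => F (update g r (f r)))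
    (by simp) (by intro f hf; simpa using hF g hg r)
  have s2 := slice_le hn P hP q c (fun f => True ∧ F (update g r (f r)))
    (fun f => F (update (update f j v) r (g r)))
    (by intro f x; simp [hqr.symm]) (by
      intro f hf
      have := hF (update (update f j v) r (g r))
        (hup _ (hup _ hf _ _ hv) _ _ (Fintype.mem_piFinset.mp hg r)) q
      have e : ∀ x, update (update (update f q x) j v) r (g r)
          = update (update (update f j v) r (g r)) q x := by
        intro x
        rw [update_comm hqj, update_comm hqr]
      simpa only [e] using this)
  have s3 := slice_le hn P hP j c (fun f => (True ∧ F (update g r (f r))) ∧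
    F (update (update f j v) r (g r))) F (by intro f x; simp [hrj]) (fun f hf => hF f hf j)
  simp only [true_and, filter_true, hT] at s1 s2 s3
  push_cast at s1
  have s4 : c ^ 3 * n ^ k ≤ (((Fintype.piFinset P).filter (fun f => (F (update g r (f r)) ∧
    F (update (update f j v) r (g r))) ∧ F f)).card : ℝ) := by
    refine le_trans ?_ s3
    refine le_trans ?_ (mul_le_mul_of_nonneg_left s2 hc.le)
    refine le_trans (le_of_eq ?_)
      (mul_le_mul_of_nonneg_left (mul_le_mul_of_nonneg_left s1 hc.le) hc.le)
    ring
  have b := bad_le P hP U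
  have b' : (n : ℝ) * ((Fintype.piFinset P).filter (fun f => ∃ i, f i ∈ U)).card
      ≤ k * U.card * n ^ k := by exact_mod_cast b
  have hn' : (0:ℝ) < n := by exact_mod_cast hn
  have b2 : (((Fintype.piFinset P).filter (fun f => ∃ i, f i ∈ U)).card : ℝ)
      ≤ c ^ 3 / 2 * n ^ k := by
    have := mul_le_mul_of_nonneg_right hU (show (0:ℝ) ≤ n ^ k by positivity)
    refine le_of_mul_le_mul_left (b'.trans (this.trans (le_of_eq ?_))) hn'
    ring
  have u : ((Fintype.piFinset P).filter (fun f => (F (update g r (f r)) ∧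
    F (update (update f j v) r (g r))) ∧ F f)).card ≤
    ((Fintype.piFinset P).filter (fun f => F f ∧ (∀ i, f i ∉ U) ∧
      F (update g r (f r)) ∧ F (update (update f j v) r (g r)))).card +
    ((Fintype.piFinset P).filter (fun f => ∃ i, f i ∈ U)).card := by
    refine le_trans (card_le_card ?_) (card_union_le _ _)
    intro f
    simp only [mem_filter, mem_union]
    rintro ⟨a, ⟨b, d⟩, e⟩
    by_cases hh : ∃ i, f i ∈ U
    · exact Or.inr ⟨a, hh⟩
    · push Not at hh
      exact Or.inl ⟨a, e, hh, b, d⟩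
  have u' : (((Fintype.piFinset P).filter (fun f => (F (update g r (f r)) ∧
    F (update (update f j v) r (g r))) ∧ F f)).card : ℝ) ≤
    ((Fintype.piFinset P).filter (fun f => F f ∧ (∀ i, f i ∉ U) ∧
      F (update g r (f r)) ∧ F (update (update f j v) r (g r)))).card +
    ((Fintype.piFinset P).filter (fun f => ∃ i, f i ∈ U)).card := by exact_mod_cast u
  linarith

end

section
open Finset Function

theorem class_unique {k : ℕ} {α : Type} {P : Fin k → Finset α}
    (hpart : ∀ v : α, ∃! i, v ∈ P i) {v : α} {i j : Fin k} (hi : v ∈ P i) (hj : v ∈ P j) : i = j :=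
  (hpart v).unique hi hj

theorem card_sum_classes {k : ℕ} {α : Type} [DecidableEq α] {P : Fin k → Finset α}
    (hpart : ∀ v : α, ∃! i, v ∈ P i) (S : Finset α) : S.card = ∑ i, (S ∩ P i).card := by
  rw [← card_biUnion]
  · congr 1
    ext v
    obtain ⟨i, hi, _⟩ := hpart v
    simp only [mem_biUnion, mem_univ, true_and, mem_inter]
    exact ⟨fun h => ⟨i, h, hi⟩, fun ⟨_, h, _⟩ => h⟩
  · intro i _ j _ hij
    rw [Function.onFun, disjoint_left]
    intro v hv hv'
    exact hij (class_unique hpart (mem_inter.mp hv).2 (mem_inter.mp hv').2)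

theorem image_inter_class {k : ℕ} {α : Type} [DecidableEq α] {P : Fin k → Finset α}
    (hpart : ∀ v : α, ∃! i, v ∈ P i) {f : Fin k → α} (hf : f ∈ Fintype.piFinset P) (i : Fin k) :
    univ.image f ∩ P i = {f i} := by
  rw [Fintype.mem_piFinset] at hf
  ext x
  simp only [mem_inter, mem_image, mem_univ, true_and, mem_singleton]
  constructor
  · rintro ⟨⟨a, rfl⟩, h⟩
    rw [class_unique hpart (hf a) h]
  · rintro rfl
    exact ⟨⟨i, rfl⟩, hf i⟩

theorem image_inj {k : ℕ} {α : Type} [DecidableEq α] {P : Fin k → Finset α}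
    (hpart : ∀ v : α, ∃! i, v ∈ P i) {f g : Fin k → α} (hf : f ∈ Fintype.piFinset P)
    (hg : g ∈ Fintype.piFinset P) (h : univ.image f = univ.image g) : f = g := by
  ext i
  have h1 := image_inter_class hpart hf i
  rw [h, image_inter_class hpart hg i] at h1
  exact (singleton_injective h1).symm

theorem exists_trans {k : ℕ} {α : Type} [DecidableEq α] {P : Fin k → Finset α}
    (hpart : ∀ v : α, ∃! i, v ∈ P i) (e : Finset α) (he : ∀ i, (e ∩ P i).card = 1) :
    ∃ f ∈ Fintype.piFinset P, univ.image f = e := by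
  have h : ∀ i, ∃ x, e ∩ P i = {x} := fun i => card_eq_one.mp (he i)
  choose f hf using h
  have hm : ∀ i, f i ∈ e ∩ P i := fun i => by rw [hf i]; simp
  refine ⟨f, Fintype.mem_piFinset.mpr fun i => (mem_inter.mp (hm i)).2, ?_⟩
  ext x
  simp only [mem_image, mem_univ, true_and]
  constructor
  · rintro ⟨i, rfl⟩; exact (mem_inter.mp (hm i)).1
  · intro hx
    obtain ⟨i, hi, _⟩ := hpart x
    have : x ∈ e ∩ P i := mem_inter.mpr ⟨hx, hi⟩
    rw [hf i, mem_singleton] at this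
    exact ⟨i, this.symm⟩

theorem codeg_trans {k n : ℕ} (hk : 3 ≤ k) {α : Type} [Fintype α] [DecidableEq α]
    {P : Fin k → Finset α} (hpart : ∀ v : α, ∃! i, v ∈ P i)
    (c : ℝ) (E : Finset (Finset α)) (hE : ∀ e ∈ E, ∀ i, (e ∩ P i).card = 1)
    (hdeg : ∀ S : Finset α, S.card = k - 1 → (∀ i, (S ∩ P i).card ≤ 1) →
      c * n ≤ ((Finset.univ.filter (fun v => insert v S ∈ E)).card : ℝ))
    (f : Fin k → α) (hf : f ∈ Fintype.piFinset P) (i : Fin k) :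
    c * n ≤ (((P i).filter (fun x => univ.image (update f i x) ∈ E)).card : ℝ) := by
  have hf' := Fintype.mem_piFinset.mp hf
  set S := (univ.erase i).image f with hS
  have hinj : Injective f := fun a b hab => class_unique hpart (hf' a) (hab ▸ hf' b)
  have hSc : S.card = k - 1 := by
    rw [hS, card_image_of_injective _ hinj, card_erase_of_mem (mem_univ _)]; simp
  have hSi : ∀ a, (S ∩ P a).card ≤ 1 := by
    intro a
    rw [← card_singleton (f a), ← image_inter_class hpart hf a]
    apply card_le_card
    exact inter_subset_inter_right (image_subset_image (erase_subset _ _))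
  have hSP : ∀ x ∈ S, x ∉ P i := by
    intro x hx hxi
    simp only [hS, mem_image, mem_erase, mem_univ, and_true] at hx
    obtain ⟨a, ha, rfl⟩ := hx
    exact ha (class_unique hpart (hf' a) hxi)
  refine (hdeg S hSc hSi).trans ?_
  norm_cast
  apply card_le_card
  intro x
  simp only [mem_filter, mem_univ, true_and]
  intro hx
  have hxi : x ∈ P i := by
    have h1 := hE _ hx i
    obtain ⟨y, hy⟩ := card_eq_one.mp h1
    have hy' : y ∈ insert x S ∩ P i := by rw [hy]; simp
    rw [mem_inter, mem_insert] at hy'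
    rcases hy' with ⟨rfl | h, h'⟩
    · exact h'
    · exact absurd h' (hSP y h)
  refine ⟨hxi, ?_⟩
  convert hx using 1
  ext y
  simp only [hS, mem_image, mem_insert, mem_erase, mem_univ, and_true, true_and]
  constructor
  · rintro ⟨a, rfl⟩
    by_cases ha : a = i
    · subst ha; simp
    · right; exact ⟨a, ha, by simp [ha]⟩
  · rintro (rfl | ⟨a, ha, rfl⟩)
    · exact ⟨i, by simp⟩
    · exact ⟨a, by simp [ha]⟩

theorem count_sets {k n : ℕ} (hk : 3 ≤ k) (hn : 0 < n) {α : Type} [Fintype α] [DecidableEq α]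
    {P : Fin k → Finset α} (hpart : ∀ v : α, ∃! i, v ∈ P i) (hP : ∀ i, (P i).card = n)
    (c : ℝ) (hc : 0 < c) (E : Finset (Finset α)) (hE : ∀ e ∈ E, ∀ i, (e ∩ P i).card = 1)
    (hdeg : ∀ S : Finset α, S.card = k - 1 → (∀ i, (S ∩ P i).card ≤ 1) →
      c * n ≤ ((Finset.univ.filter (fun v => insert v S ∈ E)).card : ℝ))
    (j : Fin k) (S : Finset α) (hS2 : (S ∩ P j).card = 2)
    (hS1 : ∀ i, i ≠ j → (S ∩ P i).card = 1) (U : Finset α)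
    (hU : (k * (U ∪ S).card : ℝ) ≤ c ^ 3 / 2 * n) :
    c ^ 3 / 2 * n ^ k ≤ ((E.filter (fun e => Disjoint e U ∧ (
          Disjoint e S ∧ ∃ r : Fin k, r ≠ j ∧ ∃ v ∈ S ∩ P j,
            ((S \ {v}) \ P r ∪ (e ∩ P r)) ∈ E ∧
            (((e \ P j) \ P r) ∪ {v} ∪ (S ∩ P r)) ∈ E))).card : ℝ) := by
  obtain ⟨v, w, hvw, hSj⟩ := card_eq_two.mp hS2
  have hv : v ∈ S ∩ P j := by rw [hSj]; simp
  have hvj := (mem_inter.mp hv).2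
  obtain ⟨g, hg, hgS⟩ := exists_trans hpart (S \ {v}) (by
    intro i
    by_cases hi : i = j
    · subst hi
      have : (S \ {v}) ∩ P i = (S ∩ P i) \ {v} := by ext; simp; tauto
      rw [this, hSj, card_eq_one]
      refine ⟨w, ?_⟩
      rw [insert_sdiff_of_mem _ (mem_singleton_self v)]
      exact sdiff_eq_self_of_disjoint (by simpa using hvw.symm)
    · rw [← hS1 i hi]
      congr 1
      ext x
      simp only [mem_inter, mem_sdiff, mem_singleton]
      constructor
      · tauto
      · rintro ⟨a, b⟩
        refine ⟨⟨a, ?_⟩, b⟩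
        rintro rfl
        exact hi (class_unique hpart b hvj))
  obtain ⟨r, hrj⟩ : ∃ r : Fin k, r ≠ j := by
    haveI : Nontrivial (Fin k) := Fin.nontrivial_iff_two_le.mpr (by omega)
    exact exists_ne j
  have hg' := Fintype.mem_piFinset.mp hg
  have key := count_trans hk hn P hP c hc (fun f => univ.image f ∈ E)
    (fun f hf i => codeg_trans hk hpart c E hE hdeg f hf i) g hg j r hrj v hvj (U ∪ S) hU
  refine key.trans ?_
  norm_cast
  apply card_le_card_of_injOn (fun f => univ.image f)
  · intro f hf
    simp only [coe_filter, Set.mem_setOf_eq] at hf ⊢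
    obtain ⟨hfT, hfE, hfU, h1, h2⟩ := hf
    have hf' := Fintype.mem_piFinset.mp hfT
    refine ⟨hfE, ?_, ?_, r, hrj, v, hv, ?_, ?_⟩
    · rw [disjoint_left]
      intro x hx
      simp only [mem_image, mem_univ, true_and] at hx
      obtain ⟨i, rfl⟩ := hx
      have := hfU i
      simp at this; tauto
    · rw [disjoint_left]
      intro x hx
      simp only [mem_image, mem_univ, true_and] at hx
      obtain ⟨i, rfl⟩ := hx
      have := hfU i
      simp at this; tauto
    · convert h1 using 1
      rw [image_inter_class hpart hfT, ← hgS]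
      ext x
      simp only [mem_union, mem_sdiff, mem_image, mem_univ, true_and, mem_singleton]
      constructor
      · rintro (⟨⟨i, rfl⟩, h⟩ | rfl)
        · have : i ≠ r := by rintro rfl; exact h (hg' i)
          exact ⟨i, by simp [this]⟩
        · exact ⟨r, by simp⟩
      · rintro ⟨i, rfl⟩
        by_cases hi : i = r
        · subst hi; simp
        · left
          simp only [update_of_ne hi]
          exact ⟨⟨i, rfl⟩, fun h => hi (class_unique hpart (hg' i) h)⟩
    · convert h2 using 1
      have hSr : S ∩ P r = {g r} := by
        rw [← image_inter_class hpart hg r, hgS]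
        ext x
        simp only [mem_inter, mem_sdiff, mem_singleton]
        constructor
        · rintro ⟨a, b⟩
          refine ⟨⟨a, ?_⟩, b⟩
          rintro rfl
          exact hrj (class_unique hpart b hvj)
        · tauto
      rw [hSr]
      ext x
      simp only [mem_union, mem_sdiff, mem_image, mem_univ, true_and, mem_singleton]
      constructor
      · rintro ((⟨⟨⟨i, rfl⟩, h⟩, h'⟩ | rfl) | rfl)
        · have a1 : i ≠ r := by rintro rfl; exact h' (hf' i)
          have a2 : i ≠ j := by rintro rfl; exact h (hf' i)
          exact ⟨i, by simp [a1, a2]⟩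
        · exact ⟨j, by simp [hrj.symm]⟩
        · exact ⟨r, by simp⟩
      · rintro ⟨i, rfl⟩
        by_cases hi : i = r
        · subst hi; simp
        · by_cases hij : i = j
          · subst hij; simp [hi]
          · left; left
            simp only [update_of_ne hi, update_of_ne hij]
            exact ⟨⟨⟨i, rfl⟩, fun h => hij (class_unique hpart (hf' i) h)⟩,
              fun h => hi (class_unique hpart (hf' i) h)⟩
  · intro f hf g hg h
    simp only [coe_filter, Set.mem_setOf_eq] at hf hg
    exact image_inj hpart hf.1 hg.1 h

theorem card_E_le {k n : ℕ} {α : Type} [DecidableEq α]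
    {P : Fin k → Finset α} (hpart : ∀ v : α, ∃! i, v ∈ P i) (hP : ∀ i, (P i).card = n)
    (E : Finset (Finset α)) (hE : ∀ e ∈ E, ∀ i, (e ∩ P i).card = 1) : E.card ≤ n ^ k := by
  have hT : (Fintype.piFinset P).card = n ^ k := by
    rw [Fintype.card_piFinset]; simp [hP]
  rw [← hT]
  refine (card_le_card (t := (Fintype.piFinset P).image (fun f => univ.image f)) ?_).trans
    card_image_le
  intro e he
  obtain ⟨f, hf, h⟩ := exists_trans hpart e (hE e he)
  exact mem_image.mpr ⟨f, hf, h⟩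

theorem type_card {k : ℕ} {α : Type} [DecidableEq α]
    {P : Fin k → Finset α} (hpart : ∀ v : α, ∃! i, v ∈ P i) (j : Fin k) (S : Finset α)
    (hS2 : (S ∩ P j).card = 2) (hS1 : ∀ i, i ≠ j → (S ∩ P i).card = 1) : S.card = k + 1 := by
  rw [card_sum_classes hpart S, ← add_sum_erase _ _ (mem_univ j), hS2,
    sum_congr rfl (fun i hi => hS1 i (ne_of_mem_erase hi))]
  have := j.pos
  simp; omega

theorem n0_exists (k : ℕ) (c : ℝ) (hc : 0 < c) : ∃ n0 : ℕ, ∀ n : ℕ, n0 ≤ n →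
    0 < n ∧ 1 ≤ Real.log n ∧ k ^ (k + 2) ≤ n ∧
    (k : ℝ) * (k * ((32 / c^3) * ((k : ℝ) + 2) * Real.log n) + (k + 1)) ≤ c ^ 3 / 2 * n := by
  have h1 : ∀ᶠ n : ℕ in Filter.atTop, 1 ≤ Real.log n :=
    (Real.tendsto_log_atTop.comp tendsto_natCast_atTop_atTop).eventually_ge_atTop 1
  set K : ℝ := (k : ℝ) * (k * ((32 / c^3) * ((k : ℝ) + 2)) + (k + 1)) + 1 with hK
  have hK0 : 0 < K := by positivity
  have h2 : ∀ᶠ n : ℕ in Filter.atTop, ‖Real.log n‖ ≤ c ^ 3 / 2 / K * ‖(n : ℝ)‖ :=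
    tendsto_natCast_atTop_atTop.eventually
      (Real.isLittleO_log_id_atTop.bound (show 0 < c ^ 3 / 2 / K by positivity))
  have := ((Filter.eventually_gt_atTop 0).and (h1.and ((Filter.eventually_ge_atTop
    (k ^ (k + 2))).and h2)))
  obtain ⟨n0, h⟩ := Filter.eventually_atTop.mp this
  refine ⟨n0, fun n hn => ?_⟩
  obtain ⟨a, b, d, e⟩ := h n hn
  refine ⟨a, b, d, ?_⟩
  rw [Real.norm_of_nonneg (by linarith), Real.norm_of_nonneg (by positivity)] at e
  have e2 : K * Real.log n ≤ c ^ 3 / 2 * n := by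
    have := mul_le_mul_of_nonneg_left e hK0.le
    refine this.trans (le_of_eq ?_)
    field_simp
  refine le_trans ?_ e2
  have h3 : (k : ℝ) * (k + 1) * 1 ≤ (k : ℝ) * (k + 1) * Real.log n := by gcongr
  have h4 : K * Real.log n = (k : ℝ) * (k * ((32 / c^3) * ((k : ℝ) + 2) * Real.log n)) +
    (k : ℝ) * (k + 1) * Real.log n + Real.log n := by rw [hK]; ring
  rw [h4]
  linarith

end

/-- For any c > 0 there is n₀ such that any k-partite k-graph with classes
of size n ≥ n₀ and δ_{k-1}(H) ≥ cn contains a matching M' with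
|M'| ≤ (32/c³)(k+2)·log n such that for every j and every (k+1)-set S of type j,
at least 4(k+2)·log n edges of M' are S-absorbing. -/
theorem stmt9 (k : ℕ) (hk : 3 ≤ k) (c : ℝ) (hc : 0 < c) :
    ∃ n0 : ℕ, ∀ n : ℕ, n0 ≤ n →
    ∀ (α : Type) [Fintype α] [DecidableEq α],
    ∀ P : Fin k → Finset α,
    (∀ v : α, ∃! i, v ∈ P i) →
    (∀ i, (P i).card = n) →
    ∀ E : Finset (Finset α),
    (∀ e ∈ E, ∀ i, (e ∩ P i).card = 1) →
    (∀ S : Finset α, S.card = k - 1 → (∀ i, (S ∩ P i).card ≤ 1) →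
      c * n ≤ ((Finset.univ.filter (fun v => insert v S ∈ E)).card : ℝ)) →
    ∃ M' ⊆ E, (∀ a ∈ M', ∀ b ∈ M', a ≠ b → Disjoint a b) ∧
      (M'.card : ℝ) ≤ (32 / c^3) * ((k : ℝ) + 2) * Real.log n ∧
      ∀ j : Fin k, ∀ S : Finset α,
        (S ∩ P j).card = 2 → (∀ i, i ≠ j → (S ∩ P i).card = 1) →
        4 * ((k : ℝ) + 2) * Real.log n ≤ ((M'.filter (fun e =>
          Disjoint e S ∧ ∃ r : Fin k, r ≠ j ∧ ∃ v ∈ S ∩ P j,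
            ((S \ {v}) \ P r ∪ (e ∩ P r)) ∈ E ∧
            (((e \ P j) \ P r) ∪ {v} ∪ (S ∩ P r)) ∈ E)).card : ℝ) := by
  obtain ⟨n0, hn0⟩ := n0_exists k c hc
  refine ⟨n0, ?_⟩
  intro n hn α _ _ P hpart hP E hE hdeg
  obtain ⟨hnpos, hlog, hkn, hbig⟩ := hn0 n hn
  classical
  have hnR : (0:ℝ) < n := by exact_mod_cast hnpos
  set X : ℝ := (32 / c^3) * ((k : ℝ) + 2) * Real.log n with hX
  have hX0 : 0 ≤ X := by positivity
  set A : Fin k × Finset α → Finset α → Prop := fun s e =>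
    Disjoint e s.2 ∧ ∃ r : Fin k, r ≠ s.1 ∧ ∃ v ∈ s.2 ∩ P s.1,
            ((s.2 \ {v}) \ P r ∪ (e ∩ P r)) ∈ E ∧
            (((e \ P s.1) \ P r) ∪ {v} ∪ (s.2 ∩ P r)) ∈ E with hA
  set I : Finset (Fin k × Finset α) := Finset.univ.filter (fun s =>
    (s.2 ∩ P s.1).card = 2 ∧ ∀ i, i ≠ s.1 → (s.2 ∩ P i).card = 1) with hI
  by_cases hIne : I.Nonempty
  swap
  · refine ⟨∅, by simp, by simp, by simpa using hX0, ?_⟩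
    intro j S h2 h1
    exact absurd ⟨(j, S), by simp only [hI, Finset.mem_filter]; exact ⟨Finset.mem_univ _, h2, h1⟩⟩ hIne
  have hEc : ∀ e ∈ E, e.card = k := by
    intro e he
    rw [card_sum_classes hpart e, Finset.sum_congr rfl (fun i _ => hE e he i)]
    simp
  have hcount : ∀ U : Finset α, U.card ≤ k * ⌊X⌋₊ → ∀ s ∈ I,
      c ^ 3 / 2 * (n:ℝ) ^ k ≤ ((E.filter (fun e => Disjoint e U ∧ A s e)).card : ℝ) := by
    rintro U hU ⟨j, S⟩ hs
    simp only [hI, Finset.mem_filter] at hs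
    obtain ⟨-, h2, h1⟩ := hs
    refine (count_sets hk hnpos hpart hP c hc E hE hdeg j S h2 h1 U ?_).trans (le_of_eq ?_)
    · refine le_trans ?_ hbig
      have hSc := type_card hpart j S h2 h1
      have h3 : (U ∪ S).card ≤ k * ⌊X⌋₊ + (k + 1) :=
        (Finset.card_union_le _ _).trans (by omega)
      have h4 : ((U ∪ S).card : ℝ) ≤ k * ⌊X⌋₊ + (k + 1) := by exact_mod_cast h3
      have h5 := Nat.floor_le hX0
      gcongr
      refine h4.trans ?_
      gcongr
    · congr!
  have hEN : (E.card : ℝ) ≤ (n:ℝ) ^ k := by exact_mod_cast card_E_le hpart hP E hE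
  obtain ⟨M, hME, hMd, hMc, hMs⟩ := greedy_aux I hIne E k ⌊X⌋₊ (by omega) hEc A ((n:ℝ)^k) (c^3/2)
    (by positivity) (by positivity) hEN hcount ⌊X⌋₊ le_rfl
  have hc1 : c ^ 3 / 2 ≤ 1 := by
    obtain ⟨s, hs⟩ := hIne
    have h1 := hcount ∅ (by simp) s hs
    have h2 : ((E.filter (fun e => Disjoint e ∅ ∧ A s e)).card : ℝ) ≤ E.card := by
      exact_mod_cast Finset.card_filter_le _ _
    have h3 : (0:ℝ) < (n:ℝ)^k := by positivity
    by_contra hcon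
    push Not at hcon
    nlinarith
  have hIc : (I.card : ℝ) ≤ Real.exp ((k + 2) * Real.log n) := by
    have hα : Fintype.card α = k * n := by
      rw [← Finset.card_univ, card_sum_classes hpart]
      simp [hP]
    have h1 : I ⊆ Finset.univ ×ˢ Finset.powersetCard (k+1) Finset.univ := by
      rintro ⟨j, S⟩ hs
      simp only [hI, Finset.mem_filter] at hs
      simp only [Finset.mem_product, Finset.mem_univ, true_and, Finset.mem_powersetCard_univ]
      exact type_card hpart j S hs.2.1 hs.2.2
    have h2 : I.card ≤ n ^ (k + 2) := by
      calc I.card ≤ k * (k * n).choose (k + 1) := by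
            refine (Finset.card_le_card h1).trans (le_of_eq ?_)
            rw [Finset.card_product, Finset.card_powersetCard, Finset.card_univ, Finset.card_univ,
              hα, Fintype.card_fin]
        _ ≤ k * (k * n) ^ (k + 1) := Nat.mul_le_mul_left _ (Nat.choose_le_pow _ _)
        _ = k ^ (k + 2) * n ^ (k + 1) := by ring
        _ ≤ n * n ^ (k + 1) := Nat.mul_le_mul_right _ hkn
        _ = n ^ (k + 2) := by ring
    have h3 : Real.exp ((k + 2) * Real.log n) = (n : ℝ) ^ (k + 2) := by
      rw [mul_comm, Real.exp_mul, Real.exp_log hnR]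
      exact_mod_cast Real.rpow_natCast (n:ℝ) (k+2)
    rw [h3]
    exact_mod_cast h2
  refine ⟨M, hME, hMd, ?_, ?_⟩
  · rw [hMc]; exact Nat.floor_le hX0
  intro j S h2 h1
  have hjS : (j, S) ∈ I := by
    simp only [hI, Finset.mem_filter]; exact ⟨Finset.mem_univ _, h2, h1⟩
  suffices hfin : 4 * ((k : ℝ) + 2) * Real.log n ≤ ((M.filter (fun e => A (j, S) e)).card : ℝ) by
    refine hfin.trans (le_of_eq ?_)
    congr!
  set t := (M.filter (fun e => A (j, S) e)).card with ht
  have e1 : (1/2 : ℝ) ^ t ≤ I.card * (1 - c^3/2/2) ^ ⌊X⌋₊ :=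
    le_trans (Finset.single_le_sum (f := fun s => (1/2 : ℝ) ^ (M.filter (fun e => A s e)).card)
      (fun s _ => by positivity) hjS) hMs
  have e2 : Real.exp (-(t:ℝ)) ≤ (1/2 : ℝ) ^ t := by
    have : Real.exp (-(t:ℝ)) = (Real.exp (-1)) ^ t := by rw [← Real.exp_nat_mul]; congr 1; ring
    rw [this]
    have h3 : Real.exp (-1) ≤ 1/2 := by
      rw [Real.exp_neg, one_div]
      have := Real.add_one_le_exp (1:ℝ)
      exact inv_anti₀ (by norm_num) (by linarith)
    gcongr
  have e3 : (1 - c^3/2/2) ^ ⌊X⌋₊ ≤ Real.exp (-(c^3/4) * ⌊X⌋₊) := by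
    have : Real.exp (-(c^3/4) * ⌊X⌋₊) = (Real.exp (-(c^3/4))) ^ ⌊X⌋₊ := by
      rw [← Real.exp_nat_mul]; congr 1; ring
    rw [this]
    have h3 := Real.add_one_le_exp (-(c^3/4))
    have h4 : 0 ≤ 1 - c^3/2/2 := by linarith
    have h5 : 1 - c^3/2/2 ≤ Real.exp (-(c^3/4)) := by linarith
    gcongr
  have e4 : Real.exp (-(t:ℝ)) ≤ Real.exp ((k + 2) * Real.log n + -(c^3/4) * ⌊X⌋₊) := by
    rw [Real.exp_add]
    refine e2.trans (e1.trans ?_)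
    have h4 : 0 ≤ 1 - c^3/2/2 := by linarith
    exact mul_le_mul hIc e3 (by positivity) (by positivity)
  rw [Real.exp_le_exp] at e4
  have e5 : X - 1 ≤ ⌊X⌋₊ := by linarith [Nat.lt_floor_add_one X]
  have e6 : c^3/4 * (X - 1) ≤ c^3/4 * ⌊X⌋₊ := by gcongr
  have e7 : c^3/4 * X = 8 * ((k + 2) * Real.log n) := by
    rw [hX]; field_simp; norm_num
  have e8 : 1 * 1 ≤ ((k:ℝ) + 2) * Real.log n := by
    have : (0:ℝ) ≤ k := by positivity
    apply mul_le_mul _ hlog (by norm_num) (by linarith)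
    linarith
  nlinarith
end

section
/- Let 0 < γ < 1/2, k ≥ 3, and n sufficiently large. Let H be a k-partite k-graph with classes of size n and δ_{k-1}(H) ≥ n/k. If H contains no independent set with at least (1-γ)(k-1)n/k vertices in each partition class, then ν(H) ≥ n - 1. -/
namespace HM
open Finset Function

/-- Matchings in coordinate form. -/
def IsM {k n : ℕ} (F : (Fin k → Fin n) → Prop) (M : Finset (Fin k → Fin n)) : Prop :=
  (∀ a ∈ M, F a) ∧ ∀ a ∈ M, ∀ b ∈ M, a ≠ b → ∀ c, a c ≠ b c

/-- The edge `e` absorbs the pair `(u, w)`. -/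
abbrev Ab {k n : ℕ} (F : (Fin k → Fin n) → Prop) (i0 i2 : Fin k)
    (S : (Fin k → Fin n) × (Fin k → Fin n)) (e : Fin k → Fin n) : Prop :=
  F (update S.1 i0 (e i0)) ∧ F (update (update e i0 (S.2 i0)) i2 (S.2 i2))

lemma repl {k n : ℕ} (hk : 0 < k) {F : (Fin k → Fin n) → Prop} {M R : Finset (Fin k → Fin n)}
    (hM : IsM F M) (hR : R ⊆ M) {ι : Type} [Fintype ι] (Q : ι → Fin k → Fin n)
    (hF : ∀ i, F (Q i)) (hQ : ∀ i j, i ≠ j → ∀ c, Q i c ≠ Q j c)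
    (hd : ∀ i, ∀ a ∈ M, a ∉ R → ∀ c, Q i c ≠ a c) :
    IsM F (M \ R ∪ univ.image Q) ∧ #(M \ R ∪ univ.image Q) + #R = #M + Fintype.card ι := by
  have hinj : Injective Q := by
    intro i j hij
    by_contra hne
    exact hQ i j hne ⟨0, hk⟩ (by rw [hij])
  have hdis : Disjoint (M \ R) (univ.image Q) := by
    rw [Finset.disjoint_left]
    intro a ha ha'
    simp only [mem_sdiff, mem_image, mem_univ, true_and] at ha ha'
    obtain ⟨i, rfl⟩ := ha'
    exact hd i _ ha.1 ha.2 ⟨0, hk⟩ rfl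
  refine ⟨⟨?_, ?_⟩, ?_⟩
  · intro a ha
    simp only [mem_union, mem_sdiff, mem_image, mem_univ, true_and] at ha
    rcases ha with ha | ⟨i, rfl⟩
    · exact hM.1 a ha.1
    · exact hF i
  · intro a ha b hb hab c
    simp only [mem_union, mem_sdiff, mem_image, mem_univ, true_and] at ha hb
    rcases ha with ha | ⟨i, rfl⟩ <;> rcases hb with hb | ⟨j, rfl⟩
    · exact hM.2 a ha.1 b hb.1 hab c
    · exact (hd j a ha.1 ha.2 c).symm
    · exact hd i b hb.1 hb.2 c
    · exact hQ i j (fun h => hab (by rw [h])) c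
  · rw [card_union_of_disjoint hdis, card_image_of_injective _ hinj, card_univ]
    have := card_sdiff_add_card_eq_card hR
    omega

/-- Uncovered vertices in class `c`. -/
abbrev U {k n : ℕ} (M : Finset (Fin k → Fin n)) (c : Fin k) : Finset (Fin n) :=
  univ \ M.image (fun a => a c)

lemma mem_U {k n : ℕ} {M : Finset (Fin k → Fin n)} {c : Fin k} {v : Fin n} :
    v ∈ U M c ↔ ∀ a ∈ M, v ≠ a c := by
  simp only [U, mem_sdiff, mem_univ, true_and, mem_image, not_exists, not_and]
  exact ⟨fun h a ha e => h a ha e.symm, fun h a ha e => h a ha e.symm⟩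

lemma card_cov {k n : ℕ} {F : (Fin k → Fin n) → Prop} {M N : Finset (Fin k → Fin n)}
    (hM : IsM F M) (hN : N ⊆ M) (c : Fin k) : #(N.image (fun a => a c)) = #N := by
  apply card_image_of_injOn
  intro a ha b hb hab
  by_contra hne
  exact hM.2 a (hN ha) b (hN hb) hne c hab

lemma card_U {k n : ℕ} {F : (Fin k → Fin n) → Prop} {M : Finset (Fin k → Fin n)}
    (hM : IsM F M) (c : Fin k) : #(U M c) + #M = n := by
  have h := card_sdiff_add_card_eq_card (subset_univ (M.image (fun a => a c)))
  rw [card_cov hM (Subset.refl M) c] at h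
  simpa using h

/-- One absorption step. -/
lemma absorb_step {k n : ℕ} (hk : 0 < k) {F : (Fin k → Fin n) → Prop} {i0 i2 : Fin k}
    {M : Finset (Fin k → Fin n)} (hM : IsM F M) {u w e : Fin k → Fin n} (he : e ∈ M)
    (hu : ∀ c, u c ∈ U M c) (hw : ∀ c, w c ∈ U M c) (huw : ∀ c, u c ≠ w c)
    (hA : Ab F i0 i2 (u, w) e) (hi : i0 ≠ i2) :
    ∃ M', IsM F M' ∧ #M' = #M + 1 ∧ M \ {e} ⊆ M' := by
  obtain ⟨h1, h2⟩ := hA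
  simp only at h1 h2
  have hu' : ∀ c, ∀ a ∈ M, u c ≠ a c := fun c => mem_U.1 (hu c)
  have hw' : ∀ c, ∀ a ∈ M, w c ≠ a c := fun c => mem_U.1 (hw c)
  have key : ∀ c, update u i0 (e i0) c ≠ update (update e i0 (w i0)) i2 (w i2) c := by
    intro c
    by_cases hc0 : c = i0
    · subst hc0
      simp [hi, update_of_ne]
      exact fun h => hw' c e he h.symm
    · by_cases hc2 : c = i2
      · subst hc2
        simp [hc0]
        exact huw c
      · simp [hc0, hc2]
        exact hu' c e he
  obtain ⟨h3, h4⟩ := repl hk hM (R := {e}) (by simpa using he) (ι := Bool)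
    (fun b => if b then update u i0 (e i0) else update (update e i0 (w i0)) i2 (w i2))
    (by intro b; cases b <;> simp [h1, h2])
    (by
      intro b b' hb c
      cases b <;> cases b' <;> simp at hb ⊢
      · exact fun h => key c h.symm
      · exact key c)
    (by
      intro b a ha hae c
      simp at hae
      have hne := hM.2 e he a ha (fun h => hae h.symm)
      cases b
      · by_cases hc2 : c = i2
        · subst hc2; simp; exact hw' c a ha
        · by_cases hc0 : c = i0
          · subst hc0; simp [hc2]; exact hw' c a ha
          · simp [hc0, hc2]; exact hne c
      · by_cases hc0 : c = i0
        · subst hc0; simp; exact hne c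
        · simp [hc0]; exact hu' c a ha)
  refine ⟨_, h3, ?_, subset_union_left⟩
  rw [card_singleton, Fintype.card_bool] at h4
  omega

lemma absorb_all {k n C : ℕ} (hk : 0 < k) {F : (Fin k → Fin n) → Prop} [DecidablePred F]
    {i0 i2 : Fin k} (hi : i0 ≠ i2) {M0 M : Finset (Fin k → Fin n)} (hM : IsM F M) (h0 : M0 ⊆ M)
    (hC : n ≤ #M + C)
    (hA : ∀ S : (Fin k → Fin n) × (Fin k → Fin n), C ≤ #(M0.filter (fun e => Ab F i0 i2 S e))) :
    ∃ M', IsM F M' ∧ n - 1 ≤ #M' := by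
  have main : ∀ j, j ≤ C → ∃ M', IsM F M' ∧ (n - 1 ≤ #M' ∨ (n + j ≤ #M' + C ∧ #(M0 \ M') ≤ j)) := by
    intro j
    induction j with
    | zero =>
      intro _
      refine ⟨M, hM, Or.inr ⟨by omega, ?_⟩⟩
      rw [sdiff_eq_empty_iff_subset.2 h0]; simp
    | succ j ih =>
      intro hj
      obtain ⟨M', hM', h | ⟨h1, h2⟩⟩ := ih (by omega)
      · exact ⟨M', hM', Or.inl h⟩
      by_cases hbig : n - 1 ≤ #M'
      · exact ⟨M', hM', Or.inl hbig⟩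
      have hU : ∀ c, ∃ u ∈ U M' c, ∃ w ∈ U M' c, u ≠ w := by
        intro c
        have := card_U hM' c
        have h2 : 1 < #(U M' c) := by omega
        exact Finset.one_lt_card.1 h2
      choose u hu w hw huw using hU
      have hex : ∃ e ∈ M0, Ab F i0 i2 (u, w) e ∧ e ∈ M' := by
        by_contra hcon
        push Not at hcon
        have : M0.filter (fun e => Ab F i0 i2 (u, w) e) ⊆ M0 \ M' := by
          intro e he
          rw [mem_filter] at he
          exact mem_sdiff.2 ⟨he.1, hcon e he.1 he.2⟩
        have := card_le_card this
        have := hA (u, w)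
        omega
      obtain ⟨e, he0, hab, heM⟩ := hex
      obtain ⟨M'', hM'', hc, hs⟩ := absorb_step hk hM' heM hu hw huw hab hi
      refine ⟨M'', hM'', Or.inr ⟨by omega, ?_⟩⟩
      have : M0 \ M'' ⊆ insert e (M0 \ M') := by
        intro a ha
        rw [mem_sdiff] at ha
        rw [mem_insert, mem_sdiff]
        by_cases hae : a = e
        · exact Or.inl hae
        · refine Or.inr ⟨ha.1, fun h => ha.2 (hs ?_)⟩
          simp [h, hae]
      have := card_le_card this
      have := card_insert_le e (M0 \ M')
      omega
  obtain ⟨M', hM', h | ⟨h1, _⟩⟩ := main C le_rfl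
  · exact ⟨M', hM', h⟩
  · exact ⟨M', hM', by omega⟩

/-! Counting absorbers -/

lemma fiber {k n : ℕ} (hn : 0 < n) (Q Q' : (Fin k → Fin n) → Prop) [DecidablePred Q]
    [DecidablePred Q'] (i : Fin k) (hinv : ∀ e v, Q (update e i v) ↔ Q e)
    (hdeg : ∀ e, Q e → n ≤ k * #(univ.filter (fun v => Q' (update e i v)))) :
    #(univ.filter Q) ≤ k * #(univ.filter (fun e => Q e ∧ Q' e)) := by
  -- count pairs (e, v) with Q e, Q' (update e i v)
  have h1 : ∑ e ∈ univ.filter Q, #(univ.filter (fun v => Q' (update e i v)))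
      ≤ n * #(univ.filter (fun e => Q e ∧ Q' e)) := by
    rw [← card_sigma]
    have : n * #(univ.filter (fun e => Q e ∧ Q' e))
        = #((univ.filter (fun e => Q e ∧ Q' e)) ×ˢ (univ : Finset (Fin n))) := by
      rw [card_product]; simp [mul_comm]
    rw [this]
    apply card_le_card_of_injOn (fun x => (update x.1 i x.2, x.1 i))
    · rintro ⟨e, v⟩ hx
      simp at hx ⊢
      exact ⟨(hinv e v).2 hx.1, hx.2⟩
    · rintro ⟨e, v⟩ hx ⟨e', v'⟩ hx' h
      simp only [Prod.mk.injEq] at h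
      have hv : v = v' := by simpa using congrFun h.1 i
      have he : e = e' := by
        funext c
        by_cases hc : c = i
        · rw [hc]; exact h.2
        · simpa [hc] using congrFun h.1 c
      subst hv; subst he; rfl
  have h2 : n * #(univ.filter Q) ≤ k * ∑ e ∈ univ.filter Q, #(univ.filter (fun v => Q' (update e i v))) := by
    rw [mul_sum, mul_comm, ← smul_eq_mul]
    apply card_nsmul_le_sum
    intro e he
    exact hdeg e (by simpa using he)
  have : n * #(univ.filter Q) ≤ n * (k * #(univ.filter (fun e => Q e ∧ Q' e))) := by
    calc _ ≤ _ := h2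
      _ ≤ k * (n * #(univ.filter (fun e => Q e ∧ Q' e))) := Nat.mul_le_mul_left _ h1
      _ = _ := by ring
  exact Nat.le_of_mul_le_mul_left this hn

lemma count_ab {k n : ℕ} (hn : 0 < n) (F : (Fin k → Fin n) → Prop) [DecidablePred F]
    (hdeg : ∀ x i, n ≤ k * #(univ.filter (fun v => F (update x i v))))
    {i0 i1 i2 : Fin k} (h01 : i0 ≠ i1) (h02 : i0 ≠ i2) (h12 : i1 ≠ i2)
    (S : (Fin k → Fin n) × (Fin k → Fin n)) :
    n ^ k ≤ k ^ 3 * #(univ.filter (fun e => F e ∧ Ab F i0 i2 S e)) := by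
  obtain ⟨u, w⟩ := S
  let C1 : (Fin k → Fin n) → Prop := fun e => F (update (update e i0 (w i0)) i2 (w i2))
  let C0 : (Fin k → Fin n) → Prop := fun e => F (update u i0 (e i0))
  have hC1 : ∀ e v v', C1 (update (update e i0 v) i2 v') ↔ C1 e := by
    intro e v v'
    simp only [C1]
    rw [iff_iff_eq]; congr 1
    funext c
    by_cases h2 : c = i2
    · subst h2; simp
    · by_cases h0 : c = i0
      · subst h0; simp [h02]
      · simp [h0, h2]
  have hC10 : ∀ e v, C1 (update e i0 v) ↔ C1 e := by
    intro e v
    have := hC1 e v (update e i0 v i2)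
    rwa [update_eq_self] at this
  have hC12 : ∀ e v, C1 (update e i2 v) ↔ C1 e := by
    intro e v
    have := hC1 e (e i0) v
    rwa [update_eq_self] at this
  have s1 := fiber hn (fun _ => True) C1 i1 (by simp) (by
    intro e _
    refine (hdeg (update (update e i0 (w i0)) i2 (w i2)) i1).trans (le_of_eq ?_)
    congr 2
    apply filter_congr
    intro v _
    simp only [C1]
    rw [update_comm h12.symm, update_comm h01])
  have s2 := fiber hn C1 C0 i0 hC10 (by
    intro e _
    refine (hdeg u i0).trans (le_of_eq ?_)
    simp [C0])
  have s3 := fiber hn (fun e => C1 e ∧ C0 e) F i2 (by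
    intro e v
    simp only [hC12]
    simp [C0, h02]) (fun e _ => hdeg e i2)
  have hcard : #(univ.filter (fun _ : Fin k → Fin n => True)) = n ^ k := by simp
  rw [hcard] at s1
  simp only [true_and] at s1
  have heq : univ.filter (fun e => (C1 e ∧ C0 e) ∧ F e) = univ.filter (fun e => F e ∧ Ab F i0 i2 (u, w) e) := by
    apply filter_congr
    intro e _
    simp only [C1, C0, Ab]
    tauto
  rw [heq] at s3
  calc n ^ k ≤ k * #(univ.filter C1) := s1
    _ ≤ k * (k * #(univ.filter (fun e => C1 e ∧ C0 e))) := Nat.mul_le_mul_left _ s2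
    _ ≤ k * (k * (k * _)) := Nat.mul_le_mul_left _ (Nat.mul_le_mul_left _ s3)
    _ = _ := by ring

lemma count_hit {k n : ℕ} (X : Fin k → Finset (Fin n)) (μ : ℕ) (hX : ∀ c, #(X c) ≤ μ) :
    n * #(univ.filter (fun e : Fin k → Fin n => ∃ c, e c ∈ X c)) ≤ k * μ * n ^ k := by
  have h1 : univ.filter (fun e : Fin k → Fin n => ∃ c, e c ∈ X c)
      = univ.biUnion (fun c => Fintype.piFinset (update (fun _ => (univ : Finset (Fin n))) c (X c))) := by
    ext e
    simp only [mem_filter, mem_univ, true_and, mem_biUnion, Fintype.mem_piFinset]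
    constructor
    · rintro ⟨c, hc⟩
      refine ⟨c, fun a => ?_⟩
      by_cases h : a = c
      · subst h; simpa using hc
      · simp [h]
    · rintro ⟨c, hc⟩
      exact ⟨c, by simpa using hc c⟩
  have h2 : ∀ c, n * #(Fintype.piFinset (update (fun _ => (univ : Finset (Fin n))) c (X c))) ≤ μ * n ^ k := by
    intro c
    rw [Fintype.card_piFinset]
    have : ∀ a, #(update (fun _ => (univ : Finset (Fin n))) c (X c) a) = update (fun _ => n) c (#(X c)) a := by
      intro a
      by_cases h : a = c
      · subst h; simp
      · simp [h]
    simp only [this]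
    rw [prod_update_of_mem (mem_univ c)]
    simp only [prod_const]
    have hcard : #((univ : Finset (Fin k)) \ {c}) + 1 = k := by
      rw [card_sdiff_of_subset (by simp)]
      have : 0 < k := c.pos
      simp; omega
    calc n * (#(X c) * n ^ #((univ : Finset (Fin k)) \ {c}))
        = #(X c) * n ^ (#((univ : Finset (Fin k)) \ {c}) + 1) := by ring
      _ ≤ μ * n ^ k := by rw [hcard]; exact Nat.mul_le_mul_right _ (hX c)
  rw [h1]
  calc _ ≤ n * ∑ c, #(Fintype.piFinset (update (fun _ => (univ : Finset (Fin n))) c (X c))) :=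
        Nat.mul_le_mul_left _ card_biUnion_le
    _ = ∑ c, n * #(Fintype.piFinset (update (fun _ => (univ : Finset (Fin n))) c (X c))) := mul_sum _ _ _
    _ ≤ ∑ c : Fin k, μ * n ^ k := sum_le_sum (fun c _ => h2 c)
    _ = _ := by simp; ring

lemma step_exists {k n : ℕ} (hn : 0 < n) (F : (Fin k → Fin n) → Prop) [DecidablePred F]
    (hdeg : ∀ x i, n ≤ k * #(univ.filter (fun v => F (update x i v))))
    {i0 i1 i2 : Fin k} (h01 : i0 ≠ i1) (h02 : i0 ≠ i2) (h12 : i1 ≠ i2)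
    (N : Finset (Fin k → Fin n)) (hN : 2 * k ^ 4 * #N ≤ n)
    (B : Finset ((Fin k → Fin n) × (Fin k → Fin n))) :
    ∃ e, F e ∧ (∀ a ∈ N, ∀ c, e c ≠ a c) ∧
      #B ≤ 2 * k ^ 3 * #(B.filter (fun S => Ab F i0 i2 S e)) := by
  classical
  set G := univ.filter (fun e => F e ∧ ∀ a ∈ N, ∀ c, e c ≠ a c) with hG
  have hS : ∀ S, n ^ k ≤ 2 * k ^ 3 * #(G.filter (fun e => Ab F i0 i2 S e)) := by
    intro S
    have c1 := count_ab hn F hdeg h01 h02 h12 S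
    have c2 := count_hit (fun c => N.image (fun a => a c)) #N (fun c => card_image_le)
    set H := univ.filter (fun e : Fin k → Fin n => ∃ c, e c ∈ N.image (fun a => a c)) with hH
    have hsub : univ.filter (fun e => F e ∧ Ab F i0 i2 S e) ⊆ G.filter (fun e => Ab F i0 i2 S e) ∪ H := by
      intro e he
      rw [mem_filter] at he
      rw [mem_union, mem_filter, hG, hH, mem_filter, mem_filter]
      by_cases h : ∃ c, e c ∈ N.image (fun a => a c)
      · exact Or.inr ⟨mem_univ _, h⟩
      · refine Or.inl ⟨⟨mem_univ _, he.2.1, ?_⟩, he.2.2⟩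
        intro a ha c hc
        exact h ⟨c, mem_image.2 ⟨a, ha, hc.symm⟩⟩
    have c3 := (card_le_card hsub).trans (card_union_le _ _)
    have c4 : 2 * k ^ 3 * #H ≤ n ^ k := by
      refine Nat.le_of_mul_le_mul_left ?_ hn
      calc n * (2 * k ^ 3 * #H) = 2 * k ^ 3 * (n * #H) := by ring
        _ ≤ 2 * k ^ 3 * (k * #N * n ^ k) := Nat.mul_le_mul_left _ c2
        _ = (2 * k ^ 4 * #N) * n ^ k := by ring
        _ ≤ n * n ^ k := Nat.mul_le_mul_right _ hN
    have c5 := Nat.mul_le_mul_left (k ^ 3) c3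
    nlinarith
  have hpos : 0 < n ^ k := pow_pos hn k
  have hGne : G.Nonempty := by
    have := hS (fun _ => ⟨0, hn⟩, fun _ => ⟨0, hn⟩)
    rw [nonempty_iff_ne_empty]
    intro h
    rw [h] at this
    simp at this
    omega
  by_contra hcon
  push Not at hcon
  have hlt : ∀ e ∈ G, 2 * k ^ 3 * #(B.filter (fun S => Ab F i0 i2 S e)) < #B := by
    intro e he
    rw [hG, mem_filter] at he
    exact hcon e he.2.1 he.2.2
  have d1 : ∑ e ∈ G, 2 * k ^ 3 * #(B.filter (fun S => Ab F i0 i2 S e)) < #G * #B := by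
    have := sum_lt_sum_of_nonempty hGne hlt
    simpa using this
  have d2 : #B * n ^ k ≤ ∑ S ∈ B, 2 * k ^ 3 * #(G.filter (fun e => Ab F i0 i2 S e)) := by
    rw [← smul_eq_mul]
    exact card_nsmul_le_sum _ _ _ (fun S _ => hS S)
  have d3 : ∑ S ∈ B, #(G.filter (fun e => Ab F i0 i2 S e)) = ∑ e ∈ G, #(B.filter (fun S => Ab F i0 i2 S e)) :=
    sum_card_bipartiteAbove_eq_sum_card_bipartiteBelow (fun S e => Ab F i0 i2 S e)
  rw [← mul_sum, d3, mul_sum] at d2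
  have d4 : #G ≤ n ^ k := by
    refine (card_le_univ G).trans ?_
    simp
  have d5 := Nat.mul_le_mul_right #B d4
  have d6 : #B * n ^ k = n ^ k * #B := mul_comm _ _
  omega

lemma layer {k n : ℕ} (hk : 0 < k) (hn : 0 < n) (F : (Fin k → Fin n) → Prop) [DecidablePred F]
    (hdeg : ∀ x i, n ≤ k * #(univ.filter (fun v => F (update x i v))))
    {i0 i1 i2 : Fin k} (h01 : i0 ≠ i1) (h02 : i0 ≠ i2) (h12 : i1 ≠ i2)
    (N : Finset (Fin k → Fin n)) (hM : IsM F N) (J : ℕ) (hN : 2 * k ^ 4 * (#N + J) ≤ n) :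
    ∃ N', IsM F N' ∧ N ⊆ N' ∧ #N' ≤ #N + J ∧
      (#(univ.filter (fun S => ∀ e ∈ N' \ N, ¬ Ab F i0 i2 S e)) : ℝ)
        ≤ (1 - 1 / (2 * (k : ℝ) ^ 3)) ^ J * (n : ℝ) ^ (2 * k) := by
  classical
  induction J with
  | zero =>
    refine ⟨N, hM, Subset.refl _, by simp, ?_⟩
    simp
    apply le_of_eq
    ring
  | succ J ih =>
    obtain ⟨N', hM', hsub, hcard, hbad⟩ := ih ((Nat.mul_le_mul_left _ (by omega)).trans hN)
    set B := univ.filter (fun S => ∀ e ∈ N' \ N, ¬ Ab F i0 i2 S e) with hB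
    obtain ⟨e, heF, heN, heB⟩ := step_exists hn F hdeg h01 h02 h12 N'
      ((Nat.mul_le_mul_left _ (by omega)).trans hN) B
    have heN' : e ∉ N' := fun h => heN e h ⟨0, hk⟩ rfl
    refine ⟨insert e N', ⟨?_, ?_⟩, hsub.trans (subset_insert _ _), ?_, ?_⟩
    · intro a ha
      rcases mem_insert.1 ha with rfl | ha
      · exact heF
      · exact hM'.1 a ha
    · intro a ha b hb hab c
      rcases mem_insert.1 ha with hae | ha' <;> rcases mem_insert.1 hb with hbe | hb'
      · exact absurd (hae.trans hbe.symm) hab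
      · rw [hae]; exact heN b hb' c
      · rw [hbe]; exact (heN a ha' c).symm
      · exact hM'.2 a ha' b hb' hab c
    · have := card_insert_le e N'
      omega
    · have h1 : univ.filter (fun S => ∀ e' ∈ insert e N' \ N, ¬ Ab F i0 i2 S e')
          ⊆ B.filter (fun S => ¬ Ab F i0 i2 S e) := by
        intro S hS
        rw [mem_filter] at hS
        rw [mem_filter, hB, mem_filter]
        refine ⟨⟨mem_univ _, fun e' he' => hS.2 e' ?_⟩, hS.2 e ?_⟩
        · rw [mem_sdiff] at he' ⊢
          exact ⟨mem_insert_of_mem he'.1, he'.2⟩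
        · rw [mem_sdiff]
          exact ⟨mem_insert_self _ _, fun h => heN' (hsub h)⟩
      have h2 := card_le_card h1
      have h3 := card_filter_add_card_filter_not (s := B) (fun S => Ab F i0 i2 S e)
      have h2' : (#(univ.filter (fun S => ∀ e' ∈ insert e N' \ N, ¬ Ab F i0 i2 S e')) : ℝ)
        ≤ #(B.filter (fun S => ¬ Ab F i0 i2 S e)) := by exact_mod_cast h2
      have h3' : (#(B.filter (fun S => Ab F i0 i2 S e)) : ℝ) + #(B.filter (fun S => ¬ Ab F i0 i2 S e)) = #B := by
        exact_mod_cast h3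
      have h4 : (#B : ℝ) ≤ 2 * (k : ℝ) ^ 3 * #(B.filter (fun S => Ab F i0 i2 S e)) := by
        exact_mod_cast heB
      have hk3 : (1 : ℝ) ≤ (k : ℝ) ^ 3 := one_le_pow₀ (by exact_mod_cast hk)
      have h5 : (#B : ℝ) * (1 / (2 * (k : ℝ) ^ 3)) ≤ #(B.filter (fun S => Ab F i0 i2 S e)) := by
        rw [mul_one_div, div_le_iff₀ (by positivity)]
        linarith
      have h6 : 0 ≤ 1 - 1 / (2 * (k : ℝ) ^ 3) := by
        rw [sub_nonneg, div_le_one (by positivity)]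
        linarith
      calc _ ≤ (1 - 1 / (2 * (k : ℝ) ^ 3)) * #B := by linarith
        _ ≤ (1 - 1 / (2 * (k : ℝ) ^ 3)) * ((1 - 1 / (2 * (k : ℝ) ^ 3)) ^ J * (n : ℝ) ^ (2 * k)) :=
          mul_le_mul_of_nonneg_left hbad h6
        _ = _ := by ring

lemma absorber {k n : ℕ} (hk : 0 < k) (hn : 0 < n) (F : (Fin k → Fin n) → Prop) [DecidablePred F]
    (hdeg : ∀ x i, n ≤ k * #(univ.filter (fun v => F (update x i v))))
    {i0 i1 i2 : Fin k} (h01 : i0 ≠ i1) (h02 : i0 ≠ i2) (h12 : i1 ≠ i2)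
    (J : ℕ) (hJ : (1 - 1 / (2 * (k : ℝ) ^ 3)) ^ J * (n : ℝ) ^ (2 * k) < 1)
    (C : ℕ) (hC : 2 * k ^ 4 * (C * J) ≤ n) :
    ∃ M0, IsM F M0 ∧ #M0 ≤ C * J ∧ ∀ S : (Fin k → Fin n) × (Fin k → Fin n),
      C ≤ #(M0.filter (fun e => Ab F i0 i2 S e)) := by
  classical
  induction C with
  | zero => exact ⟨∅, ⟨by simp, by simp⟩, by simp, by simp⟩
  | succ C ih =>
    have hCJ : (C + 1) * J = C * J + J := by ring
    obtain ⟨N, hN, hc, hA⟩ := ih ((Nat.mul_le_mul_left _ (by omega)).trans hC)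
    obtain ⟨N', hN', hsub, hc', hbad⟩ := layer hk hn F hdeg h01 h02 h12 N hN J
      ((Nat.mul_le_mul_left _ (by omega)).trans hC)
    refine ⟨N', hN', by omega, fun S => ?_⟩
    have hb := lt_of_le_of_lt hbad hJ
    have hb' : #(univ.filter (fun S => ∀ e ∈ N' \ N, ¬ Ab F i0 i2 S e)) = 0 := by
      have : #(univ.filter (fun S => ∀ e ∈ N' \ N, ¬ Ab F i0 i2 S e)) < 1 := by exact_mod_cast hb
      omega
    rw [card_eq_zero] at hb'
    have hS : ∃ e ∈ N' \ N, Ab F i0 i2 S e := by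
      by_contra hcon
      push Not at hcon
      have : S ∈ univ.filter (fun S => ∀ e ∈ N' \ N, ¬ Ab F i0 i2 S e) :=
        mem_filter.2 ⟨mem_univ _, fun e he h => hcon e he h⟩
      rw [hb'] at this
      simp at this
    obtain ⟨e, he, hab⟩ := hS
    rw [mem_sdiff] at he
    have h1 : insert e (N.filter (fun e => Ab F i0 i2 S e)) ⊆ N'.filter (fun e => Ab F i0 i2 S e) := by
      intro a ha
      rcases mem_insert.1 ha with rfl | ha
      · exact mem_filter.2 ⟨he.1, hab⟩
      · rw [mem_filter] at ha ⊢
        exact ⟨hsub ha.1, ha.2⟩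
    have h2 := card_le_card h1
    rw [card_insert_of_notMem (by simp [he.2])] at h2
    have := hA S
    omega

/-- Asymptotics. -/
lemma asym (k K : ℕ) (hk : 0 < k) (hK : 0 < K) : ∃ n0 : ℕ, ∀ n ≥ n0,
    (1 - 1 / (2 * (k : ℝ) ^ 3)) ^ (n / K) * (n : ℝ) ^ (2 * k) < 1 := by
  set r : ℝ := 1 - 1 / (2 * (k : ℝ) ^ 3) with hr
  have hk3 : (1 : ℝ) ≤ (k : ℝ) ^ 3 := one_le_pow₀ (by exact_mod_cast hk)
  have h0 : 0 ≤ r := by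
    rw [hr, sub_nonneg, div_le_one (by positivity)]
    linarith
  have h1 : r < 1 := by
    have : 0 < 1 / (2 * (k : ℝ) ^ 3) := by positivity
    linarith
  have ht := tendsto_pow_const_mul_const_pow_of_abs_lt_one (2 * k) (r := r) (by rw [abs_of_nonneg h0]; exact h1)
  have ht2 := ht.const_mul ((2 * (K : ℝ)) ^ (2 * k))
  rw [mul_zero] at ht2
  obtain ⟨m0, hm0⟩ := Filter.eventually_atTop.1 (ht2.eventually_lt_const (zero_lt_one))
  refine ⟨K * (m0 + 1), fun n hn => ?_⟩
  have hm : m0 + 1 ≤ n / K := by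
    rw [Nat.le_div_iff_mul_le hK]; linarith
  have hlt := hm0 (n / K) (by omega)
  have hn2 : n ≤ 2 * K * (n / K) := by
    have h3 := Nat.div_add_mod n K
    have h4 := Nat.mod_lt n hK
    have h5 : K * 1 ≤ K * (n / K) := Nat.mul_le_mul_left _ (by omega)
    nlinarith
  have hn3 : (n : ℝ) ≤ 2 * K * ((n / K : ℕ) : ℝ) := by exact_mod_cast hn2
  calc r ^ (n / K) * (n : ℝ) ^ (2 * k) ≤ r ^ (n / K) * (2 * K * ((n / K : ℕ) : ℝ)) ^ (2 * k) := by
        gcongr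
    _ = (2 * (K : ℝ)) ^ (2 * k) * (((n / K : ℕ) : ℝ) ^ (2 * k) * r ^ (n / K)) := by
        rw [mul_pow (2 * (K : ℝ))]; ring
    _ < 1 := hlt

lemma select {ι β : Type} [DecidableEq β] [Fintype ι] (k : ℕ) (hι : Fintype.card ι ≤ k)
    (T : ι → Finset β) (hT : ∀ i, k ≤ #(T i)) : ∃ g : ι → β, Injective g ∧ ∀ i, g i ∈ T i := by
  rw [← Finset.all_card_le_biUnion_card_iff_exists_injective]
  intro s
  rcases s.eq_empty_or_nonempty with rfl | ⟨i, hi⟩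
  · simp
  · calc #s ≤ Fintype.card ι := card_le_univ s
      _ ≤ k := hι
      _ ≤ #(T i) := hT i
      _ ≤ _ := card_le_card (subset_biUnion_of_mem T hi)

lemma almost {k n : ℕ} (hk : 2 ≤ k) (F : (Fin k → Fin n) → Prop) [DecidablePred F]
    (hdeg : ∀ x i, n ≤ k * #(univ.filter (fun v => F (update x i v))))
    (γ : ℝ) (hW : ∀ W : Fin k → Finset (Fin n),
      (∀ i, (1 - γ) * ((k : ℝ) - 1) * n / k ≤ (#(W i) : ℝ)) → ∃ f, F f ∧ ∀ i, f i ∈ W i)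
    (M0 : Finset (Fin k → Fin n)) (hM0 : IsM F M0) (t : ℕ) (ht0 : 0 < t)
    (ht : 2 * (k : ℝ) ^ 2 ≤ γ * t) (hμ : 2 * (k : ℝ) * #M0 ≤ γ * n) :
    ∃ M, IsM F M ∧ M0 ⊆ M ∧ n ≤ #M + k * t := by
  classical
  have hk0 : 0 < k := by omega
  obtain ⟨M, hMmem, hMmax⟩ := exists_max_image
    (univ.filter (fun M : Finset (Fin k → Fin n) => IsM F M ∧ M0 ⊆ M)) card
    ⟨M0, by simp [hM0]⟩
  obtain ⟨hM, hM0M⟩ : IsM F M ∧ M0 ⊆ M := by simpa using hMmem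
  refine ⟨M, hM, hM0M, ?_⟩
  by_contra hlt
  push Not at hlt
  -- no improvements
  have noimp : ∀ (R : Finset (Fin k → Fin n)), R ⊆ M \ M0 → ∀ (ι : Type) [Fintype ι] (Q : ι → Fin k → Fin n),
      (∀ i, F (Q i)) → (∀ i j, i ≠ j → ∀ c, Q i c ≠ Q j c) →
      (∀ i, ∀ a ∈ M, a ∉ R → ∀ c, Q i c ≠ a c) → Fintype.card ι ≤ #R := by
    intro R hR ι _ Q hF hQ hd
    obtain ⟨h1, h2⟩ := repl hk0 hM (hR.trans sdiff_subset) Q hF hQ hd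
    have h3 := hMmax (M \ R ∪ univ.image Q) (by
      rw [mem_filter]
      refine ⟨mem_univ _, h1, ?_⟩
      intro a ha
      rw [mem_union, mem_sdiff]
      refine Or.inl ⟨hM0M ha, fun h => ?_⟩
      exact (mem_sdiff.1 (hR h)).2 ha)
    omega
  -- the transversals A
  have hemb : ∀ c, Nonempty ((Fin k × Fin t) ↪ U M c) := by
    intro c
    apply Function.Embedding.nonempty_of_card_le
    have := card_U hM c
    simp only [Fintype.card_prod, Fintype.card_fin, Fintype.card_coe]
    omega
  let emb : ∀ c, (Fin k × Fin t) ↪ U M c := fun c => (hemb c).some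
  obtain ⟨A, hAU, hAinj⟩ : ∃ A : Fin k × Fin t → Fin k → Fin n,
      (∀ p c, ∀ a ∈ M, A p c ≠ a c) ∧ ∀ p q, p ≠ q → ∀ c, A p c ≠ A q c := by
    refine ⟨fun p c => (emb c p).1, fun p c => mem_U.1 (emb c p).2, ?_⟩
    intro p q hpq c h
    exact hpq ((emb c).injective (Subtype.ext h))
  let cnt : Fin k → Fin n → Finset (Fin t) :=
    fun i v => univ.filter (fun s : Fin t => F (update (A (i, s)) i v))
  have hcnt : ∀ i v s, s ∈ cnt i v ↔ F (update (A (i, s)) i v) := by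
    intro i v s; simp [cnt]
  let D : Fin k → Finset (Fin n) :=
    fun i => ((M \ M0).image (fun a => a i)).filter (fun v => k ≤ #(cnt i v))
  have hDk : ∀ i v, v ∈ D i → k ≤ #(cnt i v) := fun i v hv => (mem_filter.1 hv).2
  -- uncovered vertices have count zero
  have hunc : ∀ i v, (∀ a ∈ M, v ≠ a i) → #(cnt i v) = 0 := by
    intro i v hv
    rw [card_eq_zero, eq_empty_iff_forall_notMem]
    intro s hs
    rw [hcnt] at hs
    have := noimp ∅ (empty_subset _) Unit (fun _ => update (A (i, s)) i v) (fun _ => hs)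
      (fun i j hij => absurd (Subsingleton.elim i j) hij) (by
        intro _ a ha _ c
        by_cases hc : c = i
        · subst hc; simpa using hv a ha
        · simpa [hc] using hAU (i, s) c a ha)
    simp at this
  -- each edge has at most one vertex in D
  have hone : ∀ e ∈ M \ M0, ∀ i j, e i ∈ D i → e j ∈ D j → i = j := by
    intro e he i j hi hj
    by_contra hij
    obtain ⟨s, hs⟩ : (cnt i (e i)).Nonempty := card_pos.1 (lt_of_lt_of_le hk0 (hDk _ _ hi))
    obtain ⟨s', hs'⟩ : (cnt j (e j)).Nonempty := card_pos.1 (lt_of_lt_of_le hk0 (hDk _ _ hj))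
    rw [hcnt] at hs hs'
    have heM : e ∈ M := (mem_sdiff.1 he).1
    have key : ∀ c, update (A (i, s)) i (e i) c ≠ update (A (j, s')) j (e j) c := by
      intro c
      by_cases hci : c = i
      · subst hci
        simp [hij]
        exact fun h => hAU _ _ e heM h.symm
      · by_cases hcj : c = j
        · subst hcj
          simp [hci]
          exact hAU _ _ e heM
        · simp [hci, hcj]
          exact hAinj _ _ (by simp [hij]) c
    have hgen : ∀ (i : Fin k) s, ∀ a ∈ M, a ∉ ({e} : Finset (Fin k → Fin n)) → ∀ c,
        update (A (i, s)) i (e i) c ≠ a c := by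
      intro i s a ha hae c
      rw [mem_singleton] at hae
      by_cases hc : c = i
      · subst hc; simpa using hM.2 e heM a ha (fun h => hae h.symm) c
      · simpa [hc] using hAU (i, s) c a ha
    have := noimp {e} (by simpa using he) Bool
      (fun b => if b then update (A (i, s)) i (e i) else update (A (j, s')) j (e j))
      (by intro b; cases b <;> simp [hs, hs'])
      (by
        intro b b' hb c
        cases b <;> cases b' <;> simp at hb ⊢
        · exact fun h => key c h.symm
        · exact key c)
      (by
        intro b
        cases b
        · simpa using hgen j s'
        · simpa using hgen i s)
    simp at this
  -- size of D
  have hDsize : ∀ i, t * n ≤ k * (t * #M0 + t * #(D i) + k * n) := by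
    intro i
    have e1 : t * n ≤ k * ∑ s : Fin t, #(univ.filter (fun v => F (update (A (i, s)) i v))) := by
      rw [mul_sum]
      have := card_nsmul_le_sum (univ : Finset (Fin t)) (fun s => k * #(univ.filter (fun v => F (update (A (i, s)) i v)))) n
        (fun s _ => hdeg (A (i, s)) i)
      simpa using this
    have e2 : ∑ s : Fin t, #(univ.filter (fun v => F (update (A (i, s)) i v))) = ∑ v, #(cnt i v) :=
      sum_card_bipartiteAbove_eq_sum_card_bipartiteBelow (fun s v => F (update (A (i, s)) i v))
    have e3 : ∑ v, #(cnt i v) ≤ ∑ v, ((if v ∈ M0.image (fun a => a i) then t else 0)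
        + (if v ∈ D i then t else 0) + k) := by
      apply sum_le_sum
      intro v _
      have ht' : #(cnt i v) ≤ t := by
        simpa using card_le_univ (cnt i v)
      by_cases h1 : v ∈ M0.image (fun a => a i)
      · rw [if_pos h1]; omega
      · by_cases h2 : v ∈ D i
        · rw [if_pos h2]; omega
        · have : #(cnt i v) ≤ k := by
            by_contra h3
            push Not at h3
            have h4 : ∃ a ∈ M, v = a i := by
              by_contra h5
              push Not at h5
              have := hunc i v h5
              omega
            obtain ⟨a, ha, hva⟩ := h4
            apply h2
            refine mem_filter.2 ⟨mem_image.2 ⟨a, mem_sdiff.2 ⟨ha, fun h => h1 ?_⟩, hva.symm⟩, h3.le⟩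
            exact mem_image.2 ⟨a, h, hva.symm⟩
          omega
    rw [sum_add_distrib, sum_add_distrib, ← sum_filter, ← sum_filter, filter_mem_eq_inter, filter_mem_eq_inter,
      univ_inter, univ_inter, sum_const, sum_const, sum_const, card_cov hM hM0M i] at e3
    simp only [smul_eq_mul, card_univ, Fintype.card_fin] at e3
    rw [e2] at e1
    refine e1.trans (Nat.mul_le_mul_left _ ?_)
    nlinarith
  -- real version
  have hDreal : ∀ i, (1 - γ) * n / k ≤ (#(D i) : ℝ) := by
    intro i
    have h1 : (t : ℝ) * n ≤ k * (t * #M0 + t * #(D i) + k * n) := by exact_mod_cast hDsize i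
    have hkr : (0 : ℝ) < k := by exact_mod_cast hk0
    have htr : (0 : ℝ) < t := by exact_mod_cast ht0
    have hnr : (0 : ℝ) ≤ n := by positivity
    rw [div_le_iff₀ hkr]
    have h2 : 2 * (k : ℝ) ^ 2 * n ≤ γ * t * n := mul_le_mul_of_nonneg_right ht hnr
    have h3 : t * (2 * (k : ℝ) * #M0) ≤ t * (γ * n) := mul_le_mul_of_nonneg_left hμ htr.le
    have h4 : t * ((1 - γ) * n) ≤ t * (#(D i) * k : ℝ) := by nlinarith
    exact le_of_mul_le_mul_left h4 htr
  -- the set W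
  let EW : Fin k → Finset (Fin k → Fin n) :=
    fun i => (M \ M0).filter (fun e => ∃ j, j ≠ i ∧ e j ∈ D j)
  have hEW : ∀ i, ∑ j ∈ univ.erase i, #(D j) ≤ #(EW i) := by
    intro i
    have e1 : ∀ j, #(D j) ≤ #((M \ M0).filter (fun e => e j ∈ D j)) := by
      intro j
      have : D j ⊆ ((M \ M0).filter (fun e => e j ∈ D j)).image (fun a => a j) := by
        intro v hv
        obtain ⟨a, ha, hav⟩ := mem_image.1 (mem_filter.1 hv).1
        refine mem_image.2 ⟨a, mem_filter.2 ⟨ha, ?_⟩, hav⟩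
        rw [hav]; exact hv
      exact (card_le_card this).trans card_image_le
    calc ∑ j ∈ univ.erase i, #(D j) ≤ ∑ j ∈ univ.erase i, #((M \ M0).filter (fun e => e j ∈ D j)) :=
          sum_le_sum (fun j _ => e1 j)
      _ = #((univ.erase i).biUnion (fun j => (M \ M0).filter (fun e => e j ∈ D j))) := by
          rw [card_biUnion]
          intro a _ b _ hab
          refine Finset.disjoint_left.2 ?_
          intro e he he'
          rw [mem_filter] at he he'
          exact hab (hone e he.1 a b he.2 he'.2)
      _ ≤ #(EW i) := by
          apply card_le_card
          intro e he
          rw [mem_biUnion] at he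
          obtain ⟨j, hj, he⟩ := he
          rw [mem_filter] at he
          exact mem_filter.2 ⟨he.1, j, (mem_erase.1 hj).1, he.2⟩
  obtain ⟨f, hfF, hfW⟩ := hW (fun i => (EW i).image (fun a => a i)) (by
    intro i
    have hsub : EW i ⊆ M := (filter_subset _ _).trans sdiff_subset
    rw [card_cov hM hsub i]
    have h1 : ∑ j ∈ univ.erase i, (1 - γ) * (n : ℝ) / k ≤ ∑ j ∈ univ.erase i, (#(D j) : ℝ) :=
      sum_le_sum (fun j _ => hDreal j)
    have h2 : (∑ j ∈ univ.erase i, (#(D j) : ℝ)) ≤ #(EW i) := by exact_mod_cast hEW i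
    rw [sum_const, card_erase_of_mem (mem_univ i), card_univ, Fintype.card_fin, nsmul_eq_mul,
      Nat.cast_sub (by omega)] at h1
    refine le_trans (le_of_eq ?_) (h1.trans h2)
    push_cast
    ring)
  have hfe : ∀ c, ∃ e ∈ M \ M0, (∃ j, j ≠ c ∧ e j ∈ D j) ∧ e c = f c := by
    intro c
    obtain ⟨e, he, hec⟩ := mem_image.1 (hfW c)
    rw [mem_filter] at he
    exact ⟨e, he.1, he.2, hec⟩
  choose g hgM hgD hgf using hfe
  have huniq : ∀ c, ∀ a ∈ M, a c = f c → a = g c := by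
    intro c a ha hac
    by_contra hne
    exact hM.2 a ha (g c) (mem_sdiff.1 (hgM c)).1 hne c (hac.trans (hgf c).symm)
  set R := univ.image g with hR
  have hRM : R ⊆ M \ M0 := by
    intro a ha
    obtain ⟨c, _, rfl⟩ := mem_image.1 ha
    exact hgM c
  have hRk : #R ≤ k := by
    have := card_image_le (s := (univ : Finset (Fin k))) (f := g)
    simpa using this
  have hj : ∀ e : R, ∃ j, e.1 j ∈ D j ∧ e.1 j ≠ f j := by
    rintro ⟨e, he⟩
    obtain ⟨c, _, rfl⟩ := mem_image.1 he
    obtain ⟨j, hjc, hjD⟩ := hgD c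
    refine ⟨j, hjD, fun h => ?_⟩
    have h1 := huniq j (g c) (mem_sdiff.1 (hgM c)).1 h
    obtain ⟨j', hj'j, hj'D⟩ := hgD j
    rw [← h1] at hj'D
    exact hj'j (hone _ (hgM c) _ _ hj'D hjD)
  choose j hjD hjf using hj
  obtain ⟨s, hsinj, hs⟩ := select k (by simpa using hRk) (fun e : R => cnt (j e) (e.1 (j e)))
    (fun e => hDk _ _ (hjD e))
  have hRmem : ∀ e : R, e.1 ∈ M := fun e => (mem_sdiff.1 (hRM e.2)).1
  have hfA : ∀ p c, A p c ≠ f c := by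
    intro p c
    rw [← hgf c]
    exact hAU p c _ (mem_sdiff.1 (hgM c)).1
  have hqf : ∀ e : R, ∀ c, update (A (j e, s e)) (j e) (e.1 (j e)) c ≠ f c := by
    intro e c
    by_cases hc : c = j e
    · rw [hc]; simpa using hjf e
    · simpa [hc] using hfA _ c
  have hfin := noimp R hRM (Option R)
    (fun o => o.elim f (fun e => update (A (j e, s e)) (j e) (e.1 (j e))))
    (by
      intro o
      cases o with
      | none => exact hfF
      | some e => exact (hcnt _ _ _).1 (hs e))
    (by
      intro o o' hoo c
      cases o with
      | none =>
        cases o' with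
        | none => exact absurd rfl hoo
        | some e' => exact (hqf e' c).symm
      | some e =>
        cases o' with
        | none => exact hqf e c
        | some e' =>
          have hee : e ≠ e' := fun h => hoo (by rw [h])
          simp only [Option.elim_some]
          by_cases hc : c = j e <;> by_cases hc' : c = j e'
          · rw [← hc, ← hc', update_self, update_self]
            exact hM.2 _ (hRmem e) _ (hRmem e') (fun h => hee (Subtype.ext h)) c
          · rw [update_of_ne hc', ← hc, update_self]
            exact (hAU _ c _ (hRmem e)).symm
          · rw [update_of_ne hc, ← hc', update_self]
            exact hAU _ c _ (hRmem e')
          · rw [update_of_ne hc, update_of_ne hc']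
            refine hAinj _ _ (fun h => hee (hsinj ?_)) c
            exact (Prod.mk.inj h).2)
    (by
      intro o a ha haR c
      cases o with
      | none =>
        simp only [Option.elim_none]
        intro h
        exact haR (by
          rw [huniq c a ha h.symm]
          exact mem_image_of_mem _ (mem_univ _))
      | some e =>
        simp only [Option.elim_some]
        by_cases hc : c = j e
        · rw [← hc, update_self]
          exact hM.2 _ (hRmem e) _ ha (fun h => haR (h ▸ e.2)) c
        · rw [update_of_ne hc]
          exact hAU _ c a ha)
  simp at hfin

theorem core (k : ℕ) (hk : 3 ≤ k) (γ : ℝ) (hγ0 : 0 < γ) :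
    ∃ n0 : ℕ, ∀ n : ℕ, n0 ≤ n → ∀ (F : (Fin k → Fin n) → Prop) [DecidablePred F],
    (∀ x i, n ≤ k * #(univ.filter (fun v => F (update x i v)))) →
    (∀ W : Fin k → Finset (Fin n),
      (∀ i, (1 - γ) * ((k : ℝ) - 1) * n / k ≤ (#(W i) : ℝ)) → ∃ f, F f ∧ ∀ i, f i ∈ W i) →
    ∃ M, IsM F M ∧ n - 1 ≤ #M := by
  have hk0 : 0 < k := by omega
  obtain ⟨t, ht⟩ := exists_nat_ge (2 * (k : ℝ) ^ 2 / γ)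
  have ht' : 2 * (k : ℝ) ^ 2 ≤ γ * t := by
    rw [div_le_iff₀ hγ0] at ht; linarith
  have hkr : (0 : ℝ) < k := by exact_mod_cast hk0
  have ht0 : 0 < t := by
    rcases Nat.eq_zero_or_pos t with h | h
    · rw [h] at ht'
      have : 0 < (k : ℝ) ^ 2 := by positivity
      simp at ht'
      linarith
    · exact h
  set C := k * t with hC
  obtain ⟨K1, hK1⟩ := exists_nat_ge (2 * (k : ℝ) * C / γ)
  have hK1' : 2 * (k : ℝ) * C ≤ γ * K1 := by
    rw [div_le_iff₀ hγ0] at hK1; linarith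
  set K := K1 + 2 * k ^ 4 * C + 1 with hK
  obtain ⟨n0, hn0⟩ := asym k K hk0 (by omega)
  refine ⟨n0 + 1, fun n hn F _ hdeg hW => ?_⟩
  have hKn : K * (n / K) ≤ n := Nat.mul_div_le n K
  let i0 : Fin k := ⟨0, by omega⟩
  let i1 : Fin k := ⟨1, by omega⟩
  let i2 : Fin k := ⟨2, by omega⟩
  have h01 : i0 ≠ i1 := by simp [i0, i1]
  have h02 : i0 ≠ i2 := by simp [i0, i2]
  have h12 : i1 ≠ i2 := by simp [i1, i2]
  obtain ⟨M0, hM0, hc0, hA⟩ := absorber hk0 (by omega) F hdeg h01 h02 h12 (n / K)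
    (hn0 n (by omega)) C (by
      refine le_trans ?_ hKn
      rw [← mul_assoc]
      exact Nat.mul_le_mul_right _ (by omega))
  obtain ⟨M, hM, hsub, hMC⟩ := almost (by omega) F hdeg γ hW M0 hM0 t ht0 ht' (by
    have h1 : (#M0 : ℝ) ≤ C * ((n / K : ℕ) : ℝ) := by exact_mod_cast hc0
    have h2 : (K1 : ℝ) * ((n / K : ℕ) : ℝ) ≤ n := by
      have : K1 * (n / K) ≤ n := le_trans (Nat.mul_le_mul_right _ (by omega)) hKn
      exact_mod_cast this
    calc 2 * (k : ℝ) * #M0 ≤ 2 * (k : ℝ) * (C * ((n / K : ℕ) : ℝ)) := by gcongr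
      _ = (2 * (k : ℝ) * C) * ((n / K : ℕ) : ℝ) := by ring
      _ ≤ (γ * K1) * ((n / K : ℕ) : ℝ) := by gcongr
      _ = γ * (K1 * ((n / K : ℕ) : ℝ)) := by ring
      _ ≤ γ * n := by gcongr)
  exact absorb_all hk0 h02 hM hsub hMC hA

end HM

/-- For 0 < γ < 1/2, k ≥ 3 and n large: if H is a k-partite k-graph with
classes of size n, δ_{k-1}(H) ≥ n/k, and H has no independent set with at least
(1-γ)(k-1)n/k vertices in each class, then ν(H) ≥ n - 1. -/
theorem stmt10 (k : ℕ) (hk : 3 ≤ k) (γ : ℝ) (hγ0 : 0 < γ) (hγ1 : γ < 1 / 2) :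
    ∃ n0 : ℕ, ∀ n : ℕ, n0 ≤ n →
    ∀ (α : Type) [Fintype α] [DecidableEq α],
    ∀ P : Fin k → Finset α,
    (∀ v : α, ∃! i, v ∈ P i) →
    (∀ i, (P i).card = n) →
    ∀ E : Finset (Finset α),
    (∀ e ∈ E, ∀ i, (e ∩ P i).card = 1) →
    (∀ S : Finset α, S.card = k - 1 → (∀ i, (S ∩ P i).card ≤ 1) →
      (n : ℝ) / k ≤ ((Finset.univ.filter (fun v => insert v S ∈ E)).card : ℝ)) →
    (¬ ∃ W : Finset α, (∀ e ∈ E, ¬ e ⊆ W) ∧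
      ∀ i, (1 - γ) * ((k : ℝ) - 1) * n / k ≤ ((W ∩ P i).card : ℝ)) →
    ∃ M ⊆ E, (∀ a ∈ M, ∀ b ∈ M, a ≠ b → Disjoint a b) ∧ n - 1 ≤ M.card := by
  obtain ⟨n0, hn0⟩ := HM.core k hk γ hγ0
  refine ⟨n0, fun n hn α _ _ P hP hPc E hE hdeg hext => ?_⟩
  have hk0 : 0 < k := by omega
  have hPu : ∀ v i j, v ∈ P i → v ∈ P j → i = j := fun v i j hi hj => (hP v).unique hi hj
  let φ : ∀ i, Fin n → α := fun i y => ((P i).equivFinOfCardEq (hPc i)).symm y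
  have hφP : ∀ i y, φ i y ∈ P i := fun i y => (((P i).equivFinOfCardEq (hPc i)).symm y).2
  have hφinj : ∀ i, Function.Injective (φ i) := fun i y z h =>
    ((P i).equivFinOfCardEq (hPc i)).symm.injective (Subtype.ext h)
  have hφsurj : ∀ i, ∀ v ∈ P i, ∃ y, φ i y = v := fun i v hv =>
    ⟨(P i).equivFinOfCardEq (hPc i) ⟨v, hv⟩, by simp [φ]⟩
  have hφeq : ∀ i j y z, φ i y = φ j z → i = j ∧ y = z := by
    intro i j y z h
    have hij : i = j := hPu (φ i y) i j (hφP i y) (h ▸ hφP j z)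
    subst hij
    exact ⟨rfl, hφinj _ h⟩
  let T : (Fin k → Fin n) → Finset α := fun x => Finset.univ.image (fun i => φ i (x i))
  have hT : ∀ x v, v ∈ T x ↔ ∃ i, φ i (x i) = v := by intro x v; simp [T]
  have hdeg' : ∀ x i, n ≤ k * (Finset.univ.filter (fun v => T (Function.update x i v) ∈ E)).card := by
    intro x i
    set S : Finset α := (Finset.univ.erase i).image (fun j => φ j (x j)) with hS
    have hSm : ∀ v, v ∈ S ↔ ∃ j, j ≠ i ∧ φ j (x j) = v := by intro v; simp [hS]
    have h1 : S.card = k - 1 := by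
      rw [hS, Finset.card_image_of_injective, Finset.card_erase_of_mem (Finset.mem_univ _)]
      · simp
      · intro a b h
        exact (hφeq _ _ _ _ h).1
    have h2 : ∀ c, (S ∩ P c).card ≤ 1 := by
      intro c
      rw [Finset.card_le_one]
      intro a ha b hb
      rw [Finset.mem_inter, hSm] at ha hb
      obtain ⟨⟨j, _, rfl⟩, hj⟩ := ha
      obtain ⟨⟨j', _, rfl⟩, hj'⟩ := hb
      have e1 := hPu _ _ _ (hφP j (x j)) hj
      have e2 := hPu _ _ _ (hφP j' (x j')) hj'
      subst e1; subst e2; rfl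
    have h3 := hdeg S h1 h2
    have h4 : Finset.univ.filter (fun v => insert v S ∈ E)
        ⊆ (Finset.univ.filter (fun y => T (Function.update x i y) ∈ E)).image (φ i) := by
      intro v hv
      have hvE := (Finset.mem_filter.1 hv).2
      have hvP : v ∈ P i := by
        have h5 := hE _ hvE i
        obtain ⟨a, ha⟩ := Finset.card_pos.1 (by rw [h5]; norm_num : 0 < (insert v S ∩ P i).card)
        rw [Finset.mem_inter, Finset.mem_insert, hSm] at ha
        obtain ⟨rfl | ⟨j, hji, rfl⟩, hai⟩ := ha
        · exact hai
        · exact absurd (hPu _ _ _ (hφP j (x j)) hai) hji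
      obtain ⟨y, rfl⟩ := hφsurj i v hvP
      refine Finset.mem_image.2 ⟨y, Finset.mem_filter.2 ⟨Finset.mem_univ _, ?_⟩, rfl⟩
      convert hvE using 1
      ext a
      rw [hT, Finset.mem_insert, hSm]
      constructor
      · rintro ⟨j, rfl⟩
        by_cases hj : j = i
        · subst hj; left; simp
        · right; exact ⟨j, hj, by simp [hj]⟩
      · rintro (rfl | ⟨j, hj, rfl⟩)
        · exact ⟨i, by simp⟩
        · exact ⟨j, by simp [hj]⟩
    have h5 := (Finset.card_le_card h4).trans Finset.card_image_le
    have hkr : (0 : ℝ) < k := by exact_mod_cast hk0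
    rw [div_le_iff₀ hkr] at h3
    have h6 : n ≤ (Finset.univ.filter (fun v => insert v S ∈ E)).card * k := by exact_mod_cast h3
    calc n ≤ _ := h6
      _ ≤ _ := Nat.mul_le_mul_right _ h5
      _ = _ := mul_comm _ _
  have hW' : ∀ W : Fin k → Finset (Fin n),
      (∀ i, (1 - γ) * ((k : ℝ) - 1) * n / k ≤ ((W i).card : ℝ)) → ∃ f, T f ∈ E ∧ ∀ i, f i ∈ W i := by
    intro W hWc
    by_contra hcon
    apply hext
    let W' : Finset α := Finset.univ.biUnion (fun i => (W i).image (φ i))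
    have hW' : ∀ v, v ∈ W' ↔ ∃ i, ∃ y ∈ W i, φ i y = v := by intro v; simp [W']
    refine ⟨W', ?_, ?_⟩
    · intro e he hsub
      have hex : ∀ i, ∃ y ∈ W i, φ i y ∈ e := by
        intro i
        obtain ⟨a, ha⟩ := Finset.card_pos.1 (by rw [hE e he i]; norm_num : 0 < (e ∩ P i).card)
        rw [Finset.mem_inter] at ha
        obtain ⟨j, y, hy, rfl⟩ := (hW' a).1 (hsub ha.1)
        have := hPu _ _ _ (hφP j y) ha.2
        subst this
        exact ⟨y, hy, ha.1⟩
      choose f hfW hfe using hex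
      refine hcon ⟨f, ?_, hfW⟩
      have : T f = e := by
        ext a
        rw [hT]
        constructor
        · rintro ⟨i, rfl⟩
          exact hfe i
        · intro ha
          obtain ⟨i, hi, _⟩ := hP a
          refine ⟨i, ?_⟩
          exact Finset.card_le_one.1 (hE e he i).le _ (Finset.mem_inter.2 ⟨hfe i, hφP i _⟩) _
            (Finset.mem_inter.2 ⟨ha, hi⟩)
      show T f ∈ E
      rw [this]; exact he
    · intro i
      refine (hWc i).trans ?_
      have : ((W i).image (φ i)).card ≤ (W' ∩ P i).card := by
        apply Finset.card_le_card
        intro v hv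
        obtain ⟨y, hy, rfl⟩ := Finset.mem_image.1 hv
        exact Finset.mem_inter.2 ⟨(hW' _).2 ⟨i, y, hy, rfl⟩, hφP i y⟩
      rw [Finset.card_image_of_injective _ (hφinj i)] at this
      exact_mod_cast this
  obtain ⟨M, hM, hMc⟩ := hn0 n hn (fun x => T x ∈ E) hdeg' hW'
  · refine ⟨M.image T, ?_, ?_, ?_⟩
    · intro e he
      obtain ⟨a, ha, rfl⟩ := Finset.mem_image.1 he
      exact hM.1 a ha
    · intro e he e' he' hne
      obtain ⟨a, ha, rfl⟩ := Finset.mem_image.1 he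
      obtain ⟨b, hb, rfl⟩ := Finset.mem_image.1 he'
      rw [Finset.disjoint_left]
      intro v hv hv'
      obtain ⟨i, rfl⟩ := (hT _ _).1 hv
      obtain ⟨j, hj⟩ := (hT _ _).1 hv'
      obtain ⟨rfl, h⟩ := hφeq _ _ _ _ hj
      exact hM.2 a ha b hb (fun h => hne (by rw [h])) j h.symm
    · rw [Finset.card_image_of_injective]
      · exact hMc
      · intro a b hab
        funext i
        have : φ i (a i) ∈ T b := by rw [← hab]; exact (hT _ _).2 ⟨i, rfl⟩
        obtain ⟨j, hj⟩ := (hT _ _).1 this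
        obtain ⟨rfl, h⟩ := hφeq _ _ _ _ hj
        exact h.symm
end

section
/- Let 0 < γ ≪ ε < 1/(100k³) with γ(1-1/k-γ)^{k-1} < ε² and ε < (1/k - 4kε)^{k-1}/100, let k ≥ 3 and n be sufficiently large. Let H be a k-partite k-graph with classes of size n, δ_{k-1}(H) ≥ n/k, and suppose H contains an independent set with at least (1-γ)(k-1)n/k vertices in each class. Then ν(H) ≥ n - 1. -/
section Helpers
open Finset
open scoped Classical
set_option linter.unusedSectionVars false

structure HS (k n d g : ℕ) {α : Type} [Fintype α] [DecidableEq α] (cls : α → Fin k)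
    (F : (Fin k → α) → Prop) (W : Finset α) : Prop where
  hk : 3 ≤ k
  hn : 100 * k ^ 3 ≤ n
  hg : 100 * k ^ 3 * g ≤ n
  hd : n ≤ k * d
  hd2 : k * d ≤ n + k
  hP : ∀ i, #{v | cls v = i} = n
  hdeg : ∀ f : Fin k → α, (∀ i, cls (f i) = i) → ∀ j,
    d ≤ #{v | cls v = j ∧ F (Function.update f j v)}
  hW : ∀ f : Fin k → α, (∀ i, cls (f i) = i) → F f → ∃ i, f i ∉ W
  hB : ∀ i, #{v | cls v = i ∧ v ∉ W} ≤ d + g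

def uu (k g : ℕ) : ℕ := 10 * k ^ 2 * g + 3 * k ^ 2

/-- the atypical vertices -/
noncomputable def XX {k : ℕ} (g : ℕ) {α : Type} [Fintype α] [DecidableEq α] (cls : α → Fin k)
    (F : (Fin k → α) → Prop) (W : Finset α) : Finset α :=
  univ.filter fun v => v ∉ W ∧ ∃ U : Finset α, #U ≤ uu k g ∧ ∀ f : Fin k → α,
    (∀ i, cls (f i) = i) → f (cls v) = v → (∀ i, i ≠ cls v → f i ∈ W ∧ f i ∉ U) → ¬ F f

structure Mat {k : ℕ} {α : Type} (cls : α → Fin k)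
    (F : (Fin k → α) → Prop) (M : Finset (Fin k → α)) : Prop where
  tr : ∀ f ∈ M, ∀ i, cls (f i) = i
  ed : ∀ f ∈ M, F f
  dj : ∀ f ∈ M, ∀ f' ∈ M, ∀ i, f i = f' i → f = f'

noncomputable def VV {k : ℕ} {α : Type} [DecidableEq α] (M : Finset (Fin k → α)) : Finset α :=
  M.biUnion fun f => univ.image f

noncomputable def bc {k : ℕ} {α : Type} [DecidableEq α] (S : Finset α) (f : Fin k → α) : ℕ := #{i | f i ∈ S}

variable {k n d g : ℕ} {α : Type} [Fintype α] [DecidableEq α] {cls : α → Fin k}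
    {F : (Fin k → α) → Prop} {W : Finset α}

theorem mem_VV {M : Finset (Fin k → α)} {v : α} : v ∈ VV M ↔ ∃ f ∈ M, ∃ i, f i = v := by
  simp [VV]

theorem VV_insert {M : Finset (Fin k → α)} {f : Fin k → α} :
    VV (insert f M) = univ.image f ∪ VV M := by
  simp [VV]

theorem card_VV_le (M : Finset (Fin k → α)) : #(VV M) ≤ k * #M := by
  rw [mul_comm]
  apply card_biUnion_le_card_mul
  intro f _
  exact card_image_le.trans (by simp)

theorem Mat.ins {M : Finset (Fin k → α)} (hM : Mat cls F M) {f : Fin k → α}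
    (hf : ∀ i, cls (f i) = i) (hF : F f) (hd : ∀ i, f i ∉ VV M) :
    Mat cls F (insert f M) := by
  constructor
  · intro f' h; rcases mem_insert.1 h with rfl | h
    exacts [hf, hM.tr _ h]
  · intro f' h; rcases mem_insert.1 h with rfl | h
    exacts [hF, hM.ed _ h]
  · intro f1 h1 f2 h2 i he
    rcases mem_insert.1 h1 with rfl | h1' <;> rcases mem_insert.1 h2 with rfl | h2'
    · rfl
    · exact absurd (mem_VV.2 ⟨f2, h2', i, he.symm⟩) (hd i)
    · exact absurd (mem_VV.2 ⟨f1, h1', i, he⟩) (hd i)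
    · exact hM.dj _ h1' _ h2' i he

theorem not_mem_of_VV (hk : 3 ≤ k) {M : Finset (Fin k → α)} {f : Fin k → α}
    (hd : ∀ i, f i ∉ VV M) : f ∉ M := fun h =>
  hd ⟨0, by omega⟩ (mem_VV.2 ⟨f, h, _, rfl⟩)

theorem Mat.card_inter {M : Finset (Fin k → α)} (hM : Mat cls F M) (S : Finset α) :
    #(VV M ∩ S) = ∑ f ∈ M, bc S f := by
  rw [VV, biUnion_inter, card_biUnion]
  · apply sum_congr rfl
    intro f hf
    have hi : Function.Injective f := by
      intro i j h
      rw [← hM.tr f hf i, h, hM.tr f hf j]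
    have : univ.image f ∩ S = image f {i | f i ∈ S} := by
      ext v; simp only [mem_inter, mem_image, mem_univ, true_and, mem_filter]
      constructor
      · rintro ⟨⟨i, rfl⟩, h⟩; exact ⟨i, h, rfl⟩
      · rintro ⟨i, h, rfl⟩; exact ⟨⟨i, rfl⟩, h⟩
    rw [this, card_image_of_injective _ hi, bc]
  · intro f hf f' hf' hne
    simp only [Function.onFun]
    rw [Finset.disjoint_left]
    intro v hv hv'
    simp only [mem_inter, mem_image, mem_univ, true_and] at hv hv'
    obtain ⟨⟨i, hi⟩, -⟩ := hv
    obtain ⟨⟨j, hj⟩, -⟩ := hv'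
    have : i = j := by rw [← hM.tr f hf i, ← hM.tr f' hf' j, hi, hj]
    subst this
    exact hne (hM.dj f hf f' hf' i (hi.trans hj.symm))

theorem Mat.card_class {M : Finset (Fin k → α)} (hM : Mat cls F M) (i : Fin k) :
    #(VV M ∩ univ.filter fun v => cls v = i) = #M := by
  rw [hM.card_inter, card_eq_sum_ones]
  apply sum_congr rfl
  intro f hf
  rw [bc, card_eq_one]
  refine ⟨i, ?_⟩
  ext j
  simp [hM.tr f hf]

theorem HS.u3 (H : HS k n d g cls F W) : 3 * uu k g + 1 ≤ d := by
  have h1 := H.hn; have h2 := H.hg; have h3 := H.hd; have h4 := H.hk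
  refine le_of_mul_le_mul_left (a := k) ?_ (by omega)
  refine le_trans ?_ h3
  have : k * (3 * uu k g + 1) = 30 * (k ^ 3 * g) + 9 * k ^ 3 + k := by unfold uu; ring
  have h5 : k ≤ k ^ 3 := Nat.le_self_pow (by norm_num) k
  rw [this]
  have : 100 * k ^ 3 * g = 100 * (k ^ 3 * g) := by ring
  omega

theorem HS.gk (H : HS k n d g cls F W) : k * (2 * k * g + k) + 4 * k ^ 2 * g + k ^ 2 * (2 * g + 2)
    + 4 * k * g ≤ uu k g := by
  have h4 := H.hk
  unfold uu
  have : 3 * (k * g) ≤ k ^ 2 * g := by nlinarith [Nat.zero_le (k * g)]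
  nlinarith

theorem HS.n2 (H : HS k n d g cls F W) : 2 * d + g ≤ n := by
  have h1 := H.hn; have h2 := H.hg; have h3 := H.hd2; have h4 := H.hk
  have h5 : k ≤ k ^ 3 := Nat.le_self_pow (by norm_num) k
  have h6 : 3 * d ≤ k * d := Nat.mul_le_mul_right _ h4
  have h7 : 1 * g ≤ k ^ 3 * g := Nat.mul_le_mul_right _ (Nat.one_le_pow _ _ (by omega))
  have : 100 * k ^ 3 * g = 100 * (k ^ 3 * g) := by ring
  omega

theorem HS.cardA (H : HS k n d g cls F W) (i : Fin k) : d ≤ #{v | cls v = i ∧ v ∈ W} := by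
  have h1 := H.hP i
  have h2 := H.hB i
  have h3 := H.n2
  have h4 := card_filter_add_card_filter_not (s := univ.filter fun v => cls v = i) (fun v => v ∈ W)
  rw [filter_filter, filter_filter, h1] at h4
  omega

theorem HS.availA (H : HS k n d g cls F W) (U : Finset α) (hU : #U < d) :
    ∃ a : Fin k → α, ∀ i, cls (a i) = i ∧ a i ∈ W ∧ a i ∉ U := by
  have : ∀ i, ∃ a, cls a = i ∧ a ∈ W ∧ a ∉ U := by
    intro i
    obtain ⟨a, ha, ha'⟩ := exists_mem_notMem_of_card_lt_card (lt_of_lt_of_le hU (H.cardA i))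
    simp at ha
    exact ⟨a, ha.1, ha.2, ha'⟩
  choose a ha using this
  exact ⟨a, ha⟩

/-- neighbours of A-tuples are in B -/
theorem HS.nbrB (H : HS k n d g cls F W) {f : Fin k → α} (hf : ∀ i, cls (f i) = i) {j : Fin k}
    (hfW : ∀ i, i ≠ j → f i ∈ W) {v : α} (hv : cls v = j) (hF : F (Function.update f j v)) :
    v ∉ W := by
  intro hvW
  obtain ⟨i, hi⟩ := H.hW (Function.update f j v) (by
    intro i; by_cases h : i = j
    · subst h; simpa using hv
    · simpa [h] using hf i) hF
  apply hi
  by_cases h : i = j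
  · subst h; simpa using hvW
  · simpa [h] using hfW i h

theorem tr_update {f : Fin k → α} (hf : ∀ i, cls (f i) = i) {v : α} {j : Fin k} (hv : cls v = j) :
    ∀ i, cls (Function.update f j v i) = i := by
  intro i; by_cases h : i = j
  · subst h; simpa using hv
  · simpa [h] using hf i

theorem HS.cardB (H : HS k n d g cls F W) (i : Fin k) : d ≤ #{v | cls v = i ∧ v ∉ W} := by
  obtain ⟨a, ha⟩ := H.availA ∅ (by simpa using (by have := H.u3; omega))
  refine (H.hdeg a (fun i => (ha i).1) i).trans (card_le_card ?_)
  intro v hv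
  simp at hv ⊢
  exact ⟨hv.1, H.nbrB (fun i => (ha i).1) (fun i _ => (ha i).2.1) hv.1 hv.2⟩

theorem HS.miss (H : HS k n d g cls F W) {f : Fin k → α} (hf : ∀ i, cls (f i) = i) {j : Fin k}
    (hfW : ∀ i, i ≠ j → f i ∈ W) (S : Finset α) (hS : ∀ b ∈ S, cls b = j ∧ b ∉ W) :
    #{b ∈ S | ¬ F (Function.update f j b)} ≤ g := by
  have h1 := H.hdeg f hf j
  have h2 := H.hB j
  have h3 : #{b ∈ S | ¬ F (Function.update f j b)} + #{v | cls v = j ∧ F (Function.update f j v)}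
      ≤ #{v | cls v = j ∧ v ∉ W} := by
    rw [← card_union_of_disjoint]
    · apply card_le_card
      intro v hv
      simp at hv ⊢
      rcases hv with hv | hv
      · exact hS v hv.1
      · exact ⟨hv.1, H.nbrB hf hfW hv.1 hv.2⟩
    · rw [Finset.disjoint_left]
      intro v hv hv'
      simp at hv hv'
      exact hv.2 hv'.2
  omega

theorem HS.DC (H : HS k n d g cls F W) {N : ℕ} (hN : 0 < N) (T : Fin N → Fin k → α)
    (hT : ∀ t i, cls (T t i) = i ∧ T t i ∈ W) {j : Fin k}
    (S : Finset α) (hS : ∀ b ∈ S, cls b = j ∧ b ∉ W)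
    (hb : ∀ b ∈ S, 2 * #{t | F (Function.update (T t) j b)} ≤ N) : #S ≤ 2 * g := by
  have h1 : ∑ t, #{b ∈ S | ¬ F (Function.update (T t) j b)} ≤ N * g := by
    refine (sum_le_card_nsmul _ _ g ?_).trans (by simp)
    intro t _
    exact H.miss (fun i => (hT t i).1) (fun i _ => (hT t i).2) S hS
  have h2 : ∑ t, #{b ∈ S | ¬ F (Function.update (T t) j b)}
      = ∑ b ∈ S, #{t | ¬ F (Function.update (T t) j b)} := by
    simp only [card_filter]
    exact sum_comm
  have h3 : #S * N ≤ ∑ b ∈ S, 2 * #{t | ¬ F (Function.update (T t) j b)} := by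
    rw [← smul_eq_mul]
    apply card_nsmul_le_sum
    intro b hbS
    have := hb b hbS
    have h4 := card_filter_add_card_filter_not (s := (univ : Finset (Fin N)))
      (fun t => F (Function.update (T t) j b))
    simp only [card_univ, Fintype.card_fin] at h4
    omega
  rw [← mul_sum, ← h2] at h3
  refine le_of_mul_le_mul_left (a := N) ?_ hN
  nlinarith

theorem HS.cardX (H : HS k n d g cls F W) (j : Fin k) :
    #{v ∈ XX g cls F W | cls v = j} ≤ 2 * g := by
  set N := 2 * uu k g + 1 with hN
  have : ∀ i : Fin k, ∃ e : Fin N → α, Function.Injective e ∧ ∀ t, cls (e t) = i ∧ e t ∈ W := by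
    intro i
    obtain ⟨s, hs, hc⟩ := exists_subset_card_eq (show N ≤ #{v | cls v = i ∧ v ∈ W} from by
      have := H.u3; have := H.cardA i; omega)
    refine ⟨fun t => s.equivFin.symm (Fin.cast hc.symm t), ?_, ?_⟩
    · intro a b h
      simpa using h
    · intro t
      have := hs (s.equivFin.symm (Fin.cast hc.symm t)).2
      simpa using this
  choose e he1 he2 using this
  refine H.DC (N := N) (by omega) (fun t i => e i t) (fun t i => he2 i t) (j := j) _ ?_ ?_
  · intro b hb
    simp [XX] at hb
    exact ⟨hb.2, hb.1.1⟩
  · intro b hb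
    simp only [XX, mem_filter, mem_univ, true_and] at hb
    obtain ⟨⟨hbW, U, hU, hUF⟩, rfl⟩ := hb
    suffices h : #{t | F (Function.update (fun i => e i t) (cls b) b)} ≤ #U by omega
    have hx : ∀ t ∈ ({t | F (Function.update (fun i => e i t) (cls b) b)} : Finset (Fin N)),
        ∃ i, e i t ∈ U := by
      intro t ht
      by_contra! hcon
      refine hUF (Function.update (fun i => e i t) (cls b) b)
        (tr_update (fun i => (he2 i t).1) rfl) (by simp) ?_ (by simpa using ht)
      intro i hi
      simp only [Function.update_of_ne hi]
      exact ⟨(he2 i t).2, hcon i⟩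
    have hx' : ∀ t : Fin N, ∃ i, t ∈ ({t | F (Function.update (fun i => e i t) (cls b) b)} : Finset (Fin N)) → e i t ∈ U := by
      intro t
      by_cases ht : t ∈ ({t | F (Function.update (fun i => e i t) (cls b) b)} : Finset (Fin N))
      · obtain ⟨i, hi⟩ := hx t ht
        exact ⟨i, fun _ => hi⟩
      · exact ⟨cls b, fun h => absurd h ht⟩
    choose c hc using hx'
    apply card_le_card_of_injOn (fun t => e (c t) t)
    · intro t ht
      exact hc t ht
    · intro t _ t' _ h
      have h1 : c t = c t' := by
        have := congrArg cls h
        simpa [(he2 _ _).1] using this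
      simp only [h1] at h
      exact he1 _ h

theorem card_by_class (S : Finset α) : #S = ∑ j, #{v ∈ S | cls v = j} :=
  card_eq_sum_card_fiberwise (fun _ _ => mem_coe.2 (mem_univ _))

theorem HS.cardXX (H : HS k n d g cls F W) : #(XX g cls F W) ≤ 2 * k * g := by
  rw [card_by_class (cls := cls)]
  refine (sum_le_card_nsmul _ _ (2 * g) (fun j _ => H.cardX j)).trans ?_
  simp; nlinarith

/-- B minus X -/
noncomputable def BB {k : ℕ} (g : ℕ) {α : Type} [Fintype α] [DecidableEq α] (cls : α → Fin k)
    (F : (Fin k → α) → Prop) (W : Finset α) : Finset α :=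
  univ.filter fun v => v ∉ W ∧ v ∉ XX g cls F W

theorem HS.cardBB (H : HS k n d g cls F W) (j : Fin k) :
    d ≤ #{v ∈ BB g cls F W | cls v = j} + #{v ∈ XX g cls F W | cls v = j} := by
  refine (H.cardB j).trans (le_trans (card_le_card ?_) (card_union_le _ _))
  intro v
  simp [BB]
  tauto

theorem HS.availB (H : HS k n d g cls F W) (U : Finset α) (hU : #U ≤ uu k g) (j : Fin k) :
    ∃ a, cls a = j ∧ a ∈ BB g cls F W ∧ a ∉ U := by
  have h1 := H.cardBB j
  have h2 := H.cardX j
  have h3 := H.u3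
  have h4 := H.gk
  have h5 : 2 * g ≤ k ^ 2 * (2 * g + 2) := by
    have : 1 ≤ k ^ 2 := Nat.one_le_pow _ _ (by have := H.hk; omega)
    nlinarith
  obtain ⟨a, ha, ha'⟩ := exists_mem_notMem_of_card_lt_card
    (show #U < #{v ∈ BB g cls F W | cls v = j} by omega)
  simp at ha
  exact ⟨a, ha.2, ha.1, ha'⟩

theorem not_W_of_BB {v : α} (h : v ∈ BB g cls F W) : v ∉ W := by
  simp [BB] at h; exact h.1
theorem not_X_of_BB {v : α} (h : v ∈ BB g cls F W) : v ∉ XX g cls F W := by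
  simp [BB] at h; exact h.2
theorem not_W_of_XX {v : α} (h : v ∈ XX g cls F W) : v ∉ W := by
  simp [XX] at h; exact h.1
theorem not_BB_of_W {v : α} (h : v ∈ W) : v ∉ BB g cls F W := fun h' => not_W_of_BB h' h

theorem E1 {b : α} (hb : b ∈ BB g cls F W) (U : Finset α) (hU : #U ≤ uu k g) :
    ∃ f : Fin k → α, (∀ i, cls (f i) = i) ∧ F f ∧ f (cls b) = b ∧
      (∀ i, i ≠ cls b → f i ∉ U) ∧ bc (BB g cls F W) f = 1 := by
  have h1 := not_W_of_BB hb
  have h2 := not_X_of_BB hb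
  simp only [XX, mem_filter, mem_univ, true_and] at h2
  push Not at h2
  obtain ⟨f, hf, hfb, hfW, hF⟩ := h2 h1 U hU
  refine ⟨f, hf, hF, hfb, fun i hi => (hfW i hi).2, ?_⟩
  rw [bc, card_eq_one]
  refine ⟨cls b, ?_⟩
  ext i
  simp only [mem_filter, mem_univ, true_and, mem_singleton]
  constructor
  · intro hi
    by_contra hne
    exact not_BB_of_W (hfW i hne).1 hi
  · rintro rfl; rwa [hfb]

theorem HS.E2 (H : HS k n d g cls F W) {v : α} (hv : v ∈ XX g cls F W) (U : Finset α)
    (hU : #U ≤ uu k g) :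
    ∃ f : Fin k → α, (∀ i, cls (f i) = i) ∧ F f ∧ f (cls v) = v ∧
      (∀ i, i ≠ cls v → f i ∉ U) ∧ bc (BB g cls F W) f = 1 := by
  have hvX := hv
  simp only [XX, mem_filter, mem_univ, true_and] at hv
  obtain ⟨hvW, U', hU', hUF⟩ := hv
  have h3 := H.u3
  have hc := card_union_le U U'
  obtain ⟨a, ha⟩ := H.availA (U ∪ U') (by omega)
  have hk := H.hk
  obtain ⟨j, hj⟩ : ∃ j, j ≠ cls v := by
    have : Nontrivial (Fin k) := Fin.nontrivial_iff_two_le.2 (by omega)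
    exact exists_ne _
  have ht := tr_update (fun i => (ha i).1) (v := v) (j := cls v) rfl
  have hdg := H.hdeg _ ht j
  have h4 := H.cardX j
  have h5 := card_union_le (U ∪ U') (univ.filter fun w => w ∈ XX g cls F W ∧ cls w = j)
  have h6 := H.gk
  have h7 : 2 * g ≤ k ^ 2 * (2 * g + 2) := by
    have : 1 ≤ k ^ 2 := Nat.one_le_pow _ _ (by have := H.hk; omega)
    nlinarith
  have h8 : #(univ.filter fun w => w ∈ XX g cls F W ∧ cls w = j) =
    #{v ∈ XX g cls F W | cls v = j} := by congr 1; ext; simp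
  obtain ⟨w, hw, hw'⟩ := exists_mem_notMem_of_card_lt_card (show
    #((U ∪ U') ∪ (univ.filter fun w => w ∈ XX g cls F W ∧ cls w = j)) <
      #{w | cls w = j ∧ F (Function.update (Function.update a (cls v) v) j w)} by omega)
  simp at hw hw'
  obtain ⟨hwj, hwF⟩ := hw
  have hwX : w ∉ XX g cls F W := fun h => hw'.2.2 h hwj
  have ht2 := tr_update ht hwj
  have hwW : w ∉ W := by
    intro hwW
    refine hUF _ ht2 (by simp [hj.symm]) ?_ hwF
    intro i hi
    by_cases hij : i = j
    · subst hij; simp [hwW, hw'.2.1]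
    · simp only [Function.update_of_ne hij, Function.update_of_ne hi]
      have := (ha i).2
      simp at this
      exact ⟨this.1, this.2.2⟩
  have hwB : w ∈ BB g cls F W := by simp [BB, hwX, hwW]
  refine ⟨_, ht2, hwF, by simp [hj.symm], ?_, ?_⟩
  · intro i hi
    by_cases hij : i = j
    · subst hij; simp [hw'.1]
    · simp only [Function.update_of_ne hij, Function.update_of_ne hi]
      have := (ha i).2
      simp at this
      exact this.2.1
  · rw [bc, card_eq_one]
    refine ⟨j, ?_⟩
    ext i
    simp only [mem_filter, mem_univ, true_and, mem_singleton]
    by_cases hij : i = j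
    · subst hij; simpa using hwB
    · simp only [Function.update_of_ne hij, hij, iff_false]
      by_cases hi : i = cls v
      · subst hi
        simp only [Function.update_self]
        exact fun h => not_X_of_BB h hvX
      · simp only [Function.update_of_ne hi]
        exact not_BB_of_W (ha i).2.1

theorem HS.E3 (H : HS k n d g cls F W) (U : Finset α) (hU : #U ≤ uu k g) :
    ∃ f : Fin k → α, (∀ i, cls (f i) = i) ∧ F f ∧
      (∀ i, f i ∉ U) ∧ 2 ≤ bc (BB g cls F W) f := by
  choose a ha using fun j => H.availB U hU j
  have hk := H.hk
  have h3 := H.u3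
  let c : Fin k := ⟨2, by omega⟩
  have hdg := H.hdeg a (fun i => (ha i).1) c
  obtain ⟨w, hw, hw'⟩ := exists_mem_notMem_of_card_lt_card (show #U < _ from lt_of_lt_of_le (by omega) hdg)
  simp at hw
  refine ⟨_, tr_update (fun i => (ha i).1) hw.1, hw.2, ?_, ?_⟩
  · intro i
    by_cases hi : i = c
    · subst hi; simpa using hw'
    · simpa [hi] using (ha i).2.2
  · have : ({⟨0, by omega⟩, ⟨1, by omega⟩} : Finset (Fin k)) ⊆
        univ.filter fun i => Function.update a c w i ∈ BB g cls F W := by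
      intro i hi
      have hic : i ≠ c := by
        rintro rfl
        simp [c] at hi
      simp [hic, (ha i).2.1]
    have h := card_le_card this
    rw [card_pair (by simp)] at h
    exact h

theorem bc_le (S : Finset α) (f : Fin k → α) : bc S f ≤ k := by
  unfold bc
  exact (card_le_univ _).trans (by simp)

theorem disj_insert {M : Finset (Fin k → α)} {f : Fin k → α} {R : Finset α}
    (h : Disjoint (VV M) R) (hf : ∀ i, f i ∉ R) : Disjoint (VV (insert f M)) R := by
  rw [VV_insert, disjoint_union_left]
  refine ⟨?_, h⟩
  rw [Finset.disjoint_left]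
  intro v hv
  simp at hv
  obtain ⟨i, rfl⟩ := hv
  exact hf i

theorem HS.stage3 (H : HS k n d g cls F W) {R : Finset α} (hR : #R ≤ k ^ 2 * (2 * g + 2)) (s : ℕ)
    (hs : s ≤ 2 * k * g + k) : ∃ M, Mat cls F M ∧ #M ≤ s ∧ Disjoint (VV M) R ∧
      ∑ f ∈ M, bc (BB g cls F W) f ≤ #M + s ∧
      #M + s ≤ ∑ f ∈ M, bc (BB g cls F W) f + (k - 1) := by
  induction s with
  | zero =>
    refine ⟨∅, ⟨by simp, by simp, by simp⟩, by simp, by simp [VV], by simp, by simp⟩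
  | succ s ih =>
    obtain ⟨M, hM, hMs, hMR, h1, h2⟩ := ih (by omega)
    by_cases h : #M + (s + 1) ≤ ∑ f ∈ M, bc (BB g cls F W) f + (k - 1)
    · exact ⟨M, hM, by omega, hMR, by omega, h⟩
    have hgk := H.gk
    have hk := H.hk
    have hVM := card_VV_le M
    have hVM2 : k * #M ≤ k * (2 * k * g + k) := Nat.mul_le_mul_left _ (by omega)
    have hun := card_union_le (VV M) R
    obtain ⟨f, hf, hF, hfU, hfb⟩ := H.E3 (VV M ∪ R) (by omega)
    have hfU1 : ∀ i, f i ∉ VV M := fun i hi => hfU i (mem_union_left _ hi)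
    have hfU2 : ∀ i, f i ∉ R := fun i hi => hfU i (mem_union_right _ hi)
    have hfM := not_mem_of_VV hk hfU1
    have hbk := bc_le (BB g cls F W) f
    refine ⟨insert f M, hM.ins hf hF hfU1, ?_, disj_insert hMR hfU2, ?_, ?_⟩
    · rw [card_insert_of_notMem hfM]; omega
    · rw [card_insert_of_notMem hfM, sum_insert hfM]; omega
    · rw [card_insert_of_notMem hfM, sum_insert hfM]; omega

theorem HS.stage1 (H : HS k n d g cls F W) {R : Finset α} (hR : #R ≤ k ^ 2 * (2 * g + 2))
    (hRW : R ⊆ W) (s : ℕ)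
    (hs : s ≤ 2 * k * g + k) (hs2 : #(BB g cls F W) + s ≤ n) :
    ∃ M, Mat cls F M ∧ #M = s ∧ Disjoint (VV M) R ∧
      ∀ f ∈ M, bc (BB g cls F W) f = 0 ∧ bc (XX g cls F W) f ≤ 1 := by
  induction s with
  | zero =>
    refine ⟨∅, ⟨by simp, by simp, by simp⟩, by simp, by simp [VV], by simp⟩
  | succ s ih =>
    obtain ⟨M, hM, hMs, hMR, h1⟩ := ih (by omega) (by omega)
    have hgk := H.gk
    have hk := H.hk
    have hu3 := H.u3
    have hVM := card_VV_le M
    have hVM2 : k * #M ≤ k * (2 * k * g + k) := Nat.mul_le_mul_left _ (by omega)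
    have hun := card_union_le (VV M) R
    obtain ⟨a, ha⟩ := H.availA (VV M ∪ R) (by omega)
    have key : ∃ i v, cls v = i ∧ F (Function.update a i v) ∧ v ∉ BB g cls F W ∧
        v ∉ VV M ∩ XX g cls F W := by
      by_contra! hcon
      have hle : ∀ i, d ≤ #{v ∈ BB g cls F W | cls v = i} +
          #{v ∈ VV M ∩ XX g cls F W | cls v = i} := by
        intro i
        refine (H.hdeg a (fun i => (ha i).1) i).trans (le_trans (card_le_card ?_) (card_union_le _ _))
        intro v hv
        simp only [mem_filter, mem_univ, true_and] at hv
        have := hcon i v hv.1 hv.2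
        simp only [mem_union, mem_filter]
        tauto
      have hsum := sum_le_sum (s := univ) (fun i _ => hle i)
      rw [sum_add_distrib, ← card_by_class, ← card_by_class, hM.card_inter] at hsum
      have h2 : ∑ f ∈ M, bc (XX g cls F W) f ≤ #M := by
        rw [card_eq_sum_ones]
        exact sum_le_sum (fun f hf => (h1 f hf).2)
      have h3 := H.hd
      simp at hsum
      omega
    obtain ⟨i, v, hv, hF, hvB, hvX⟩ := key
    have hvW := H.nbrB (fun i => (ha i).1) (fun i _ => (ha i).2.1) hv hF
    have hvX2 : v ∈ XX g cls F W := by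
      by_contra h
      exact hvB (by simp [BB, h, hvW])
    have hvM : v ∉ VV M := fun h => hvX (mem_inter.2 ⟨h, hvX2⟩)
    have hfU1 : ∀ l, Function.update a i v l ∉ VV M := by
      intro l
      by_cases hl : l = i
      · subst hl; simpa using hvM
      · simp only [Function.update_of_ne hl]
        exact fun h => (ha l).2.2 (mem_union_left _ h)
    have hfU2 : ∀ l, Function.update a i v l ∉ R := by
      intro l
      by_cases hl : l = i
      · subst hl; simpa using fun h => hvW (hRW h)
      · simp only [Function.update_of_ne hl]
        exact fun h => (ha l).2.2 (mem_union_right _ h)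
    have hfM := not_mem_of_VV hk hfU1
    refine ⟨_, hM.ins (tr_update (fun i => (ha i).1) hv) hF hfU1, ?_, disj_insert hMR hfU2, ?_⟩
    · rw [card_insert_of_notMem hfM]; omega
    · intro f hf
      rcases mem_insert.1 hf with rfl | hf
      · constructor
        · rw [bc, card_eq_zero, filter_eq_empty_iff]
          intro l _
          by_cases hl : l = i
          · subst hl; simpa using hvB
          · simp only [Function.update_of_ne hl]
            exact not_BB_of_W (ha l).2.1
        · have : Nonempty (Fin k) := ⟨i⟩
          rw [bc, card_le_one_iff_subset_singleton]
          refine ⟨i, ?_⟩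
          intro l hl
          simp only [mem_filter, mem_univ, true_and] at hl
          by_contra hli
          simp only [mem_singleton] at hli
          simp only [Function.update_of_ne hli] at hl
          exact not_W_of_XX hl (ha l).2.1
      · exact h1 f hf

theorem HS.stageI (H : HS k n d g cls F W) {R : Finset α} (hR : #R ≤ k ^ 2 * (2 * g + 2))
    (hRW : R ⊆ W) :
    ∃ M, Mat cls F M ∧ #M ≤ 2 * k * g + k ∧ Disjoint (VV M) R ∧
      n + ∑ f ∈ M, bc (BB g cls F W) f ≤ #(BB g cls F W) + #M ∧
      #(BB g cls F W) + #M ≤ n + ∑ f ∈ M, bc (BB g cls F W) f + (k - 1) := by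
  have hX := H.cardXX
  have hd := H.hd
  have hd2 := H.hd2
  have hk := H.hk
  by_cases h : n ≤ #(BB g cls F W)
  · have h1 : #(BB g cls F W) ≤ k * d + k * g := by
      rw [card_by_class (cls := cls)]
      refine (sum_le_card_nsmul _ _ (d + g) (fun j _ => ?_)).trans (by simp; nlinarith)
      refine le_trans (card_le_card ?_) (H.hB j)
      intro v hv
      simp only [mem_filter, mem_univ, true_and] at hv ⊢
      exact ⟨hv.2, not_W_of_BB hv.1⟩
    have h2 : 2 * k * g = 2 * (k * g) := by ring
    obtain ⟨M, hM, h3, h4, h5, h6⟩ := H.stage3 hR (#(BB g cls F W) - n) (by omega)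
    exact ⟨M, hM, by omega, h4, by omega, by omega⟩
  · have h1 : k * d ≤ #(BB g cls F W) + #(XX g cls F W) := by
      have hsum := sum_le_sum (s := univ) (fun i _ => H.cardBB i)
      rw [sum_add_distrib, ← card_by_class, ← card_by_class] at hsum
      simpa using hsum
    obtain ⟨M, hM, h3, h4, h5⟩ := H.stage1 hR hRW (n - #(BB g cls F W)) (by omega) (by omega)
    have h6 : ∑ f ∈ M, bc (BB g cls F W) f = 0 := sum_eq_zero (fun f hf => (h5 f hf).1)
    exact ⟨M, hM, by omega, h4, by omega, by omega⟩

theorem HS.stageII (H : HS k n d g cls F W) {R : Finset α} (hR : #R ≤ k ^ 2 * (2 * g + 2))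
    (hRW : R ⊆ W) (Y : Finset α) (hY : ∀ y ∈ Y, y ∈ XX g cls F W ∨ y ∈ BB g cls F W)
    (hYc : #Y ≤ 4 * k * g) :
    ∃ M, Mat cls F M ∧ #M ≤ 2 * k * g + k + #Y ∧ Disjoint (VV M) R ∧ Y ⊆ VV M ∧
      n + ∑ f ∈ M, bc (BB g cls F W) f ≤ #(BB g cls F W) + #M ∧
      #(BB g cls F W) + #M ≤ n + ∑ f ∈ M, bc (BB g cls F W) f + (k - 1) := by
  induction Y using Finset.induction_on with
  | empty =>
    obtain ⟨M, h1, h2, h3, h4⟩ := H.stageI hR hRW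
    exact ⟨M, h1, by simpa using h2, h3, by simp, h4⟩
  | insert y Y hyY ih =>
    rw [card_insert_of_notMem hyY] at hYc ⊢
    obtain ⟨M, hM, h1, h2, h3, h4, h5⟩ := ih (fun y hy => hY y (mem_insert_of_mem hy)) (by omega)
    by_cases hyM : y ∈ VV M
    · exact ⟨M, hM, by omega, h2, insert_subset hyM h3, h4, h5⟩
    have hgk := H.gk
    have hk := H.hk
    have hVM := card_VV_le M
    have hVM2 : k * #M ≤ k * (2 * k * g + k) + 4 * k ^ 2 * g := by
      have : k * #M ≤ k * (2 * k * g + k + 4 * k * g) := Nat.mul_le_mul_left _ (by omega)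
      nlinarith
    have hun := card_union_le (VV M) R
    have : ∃ f : Fin k → α, (∀ i, cls (f i) = i) ∧ F f ∧ f (cls y) = y ∧
      (∀ i, i ≠ cls y → f i ∉ VV M ∪ R) ∧ bc (BB g cls F W) f = 1 := by
      rcases hY y (mem_insert_self _ _) with h | h
      · exact H.E2 h _ (by omega)
      · exact E1 h _ (by omega)
    obtain ⟨f, hf, hF, hfy, hfU, hb⟩ := this
    have hyW : y ∉ W := by
      rcases hY y (mem_insert_self _ _) with h | h
      · exact not_W_of_XX h
      · exact not_W_of_BB h
    have hfU1 : ∀ i, f i ∉ VV M := by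
      intro i
      by_cases hi : i = cls y
      · subst hi; rwa [hfy]
      · exact fun h => hfU i hi (mem_union_left _ h)
    have hfU2 : ∀ i, f i ∉ R := by
      intro i
      by_cases hi : i = cls y
      · subst hi; rw [hfy]; exact fun h => hyW (hRW h)
      · exact fun h => hfU i hi (mem_union_right _ h)
    have hfM := not_mem_of_VV hk hfU1
    refine ⟨_, hM.ins hf hF hfU1, ?_, disj_insert h2 hfU2, ?_, ?_, ?_⟩
    · rw [card_insert_of_notMem hfM]; omega
    · rw [VV_insert]
      apply insert_subset
      · exact mem_union_left _ (mem_image.2 ⟨cls y, mem_univ _, hfy⟩)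
      · exact h3.trans subset_union_right
    · rw [card_insert_of_notMem hfM, sum_insert hfM]; omega
    · rw [card_insert_of_notMem hfM, sum_insert hfM]; omega

theorem extend_inj {J : Type} [Fintype J] (A : Finset α) (hc : Fintype.card J ≤ #A)
    (s : Finset J) (f : J → α) (hf : ∀ p ∈ s, f p ∈ A) (hi : Set.InjOn f s) :
    ∃ e : J → α, Function.Injective e ∧ (∀ p, e p ∈ A) ∧ ∀ p ∈ s, e p = f p := by
  have h1 : s.image f ⊆ A := by
    intro v hv
    obtain ⟨p, hp, rfl⟩ := mem_image.1 hv
    exact hf p hp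
  have h2 : #(s.image f) ≤ Fintype.card J := card_image_le.trans (card_le_univ _)
  obtain ⟨t, ht1, ht2, ht3⟩ := exists_subsuperset_card_eq h1 h2 hc
  obtain ⟨e, he⟩ := Finset.exists_equiv_extend_of_card_eq ht3.symm ht1 hi
  exact ⟨fun p => e p, fun a b h => e.injective (Subtype.ext h), fun p => ht2 (e p).2, he⟩

theorem HS.core (H : HS k n d g cls F W) : ∃ M, Mat cls F M ∧ n - 1 ≤ #M := by
  have hk := H.hk
  have hgk := H.gk
  have hu3 := H.u3
  set L := 2 * g + 2 with hL
  have hLu : L ≤ k ^ 2 * L := Nat.le_mul_of_pos_left _ (Nat.pow_pos (by omega))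
  have hkL : k * L ≤ k ^ 2 * L := Nat.mul_le_mul_right _ (Nat.le_self_pow (by norm_num) k)
  -- the reserve
  have hρ : ∀ i : Fin k, ∃ e : Fin k × Fin L → α, Function.Injective e ∧
      (∀ p, e p ∈ (univ.filter fun v => cls v = i ∧ v ∈ W)) := by
    intro i
    obtain ⟨e, he1, he2, -⟩ := extend_inj (J := Fin k × Fin L)
      (univ.filter fun v => cls v = i ∧ v ∈ W)
      (by have := H.cardA i; simp; omega) ∅ (fun _ => (H.availA ∅ (by simp; omega)).choose i)
      (by simp) (by simp)
    exact ⟨e, he1, he2⟩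
  choose ρ hρi hρ2 using hρ
  simp only [mem_filter, mem_univ, true_and] at hρ2
  let R : Finset α := univ.image (fun q : Fin k × (Fin k × Fin L) => ρ q.1 q.2)
  have hRW : R ⊆ W := by
    intro v hv
    obtain ⟨q, -, rfl⟩ := mem_image.1 hv
    exact (hρ2 _ _).2
  have hRc : #R ≤ k ^ 2 * L := by
    refine card_image_le.trans (le_of_eq ?_)
    simp; ring
  -- the hard vertices
  let T : Fin k → Fin L → Fin k → α := fun j t i => ρ i (j, t)
  let Hd : Finset α := {b ∈ BB g cls F W | 2 * #{t | F (Function.update (T (cls b) t) (cls b) b)} ≤ L}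
  have hHd : #Hd ≤ 2 * k * g := by
    rw [card_by_class (cls := cls)]
    refine (sum_le_card_nsmul _ _ (2 * g) (fun j _ => ?_)).trans (by simp; nlinarith)
    refine H.DC (N := L) (by omega) (T j) (fun t i => hρ2 i _) (j := j) _ ?_ ?_
    · intro b hb
      simp only [Hd, mem_filter] at hb
      exact ⟨hb.2, not_W_of_BB hb.1.1⟩
    · intro b hb
      simp only [Hd, mem_filter] at hb
      obtain ⟨hb, rfl⟩ := hb
      exact hb.2
  have hX := H.cardXX
  have hYc : #(XX g cls F W ∪ Hd) ≤ 4 * k * g := by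
    refine (card_union_le _ _).trans ?_
    have : 4 * k * g = 2 * k * g + 2 * k * g := by ring
    omega
  obtain ⟨M, hM, hMc, hMR, hMY, hM1, hM2⟩ := H.stageII hRc hRW (XX g cls F W ∪ Hd) (by
    intro y hy
    rcases mem_union.1 hy with h | h
    · exact Or.inl h
    · exact Or.inr (mem_filter.1 h).1) hYc
  -- remaining parts
  let A' : Fin k → Finset α := fun i => {v | cls v = i ∧ v ∈ W ∧ v ∉ VV M}
  let B' : Fin k → Finset α := fun i => {v ∈ BB g cls F W | cls v = i ∧ v ∉ VV M}
  have hAB : ∀ i, #(A' i) + #(B' i) + #M = n := by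
    intro i
    rw [← hM.card_class i, ← H.hP i, ← card_union_of_disjoint, ← card_union_of_disjoint]
    · congr 1
      ext v
      simp only [A', B', mem_union, mem_filter, mem_univ, true_and, mem_inter]
      have h1 : v ∈ XX g cls F W → v ∈ VV M := fun h => hMY (mem_union_left _ h)
      have h2 : v ∈ BB g cls F W ↔ v ∉ W ∧ v ∉ XX g cls F W := by simp [BB]
      tauto
    · rw [Finset.disjoint_left]
      intro v hv hv'
      simp only [A', B', mem_union, mem_filter, mem_univ, true_and, mem_inter] at hv hv'
      tauto
    · rw [Finset.disjoint_left]
      intro v hv hv'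
      simp only [A', B', mem_filter, mem_univ, true_and] at hv hv'
      exact not_W_of_BB hv'.1 hv.2.1
  have hBsum : ∑ i, #(B' i) + ∑ f ∈ M, bc (BB g cls F W) f = #(BB g cls F W) := by
    rw [← hM.card_inter]
    have h1 : ∑ i, #(B' i) = #(BB g cls F W \ VV M) := by
      rw [card_by_class (cls := cls)]
      apply sum_congr rfl
      intro i _
      congr 1
      ext v
      simp only [B', mem_filter, mem_sdiff]
      tauto
    rw [h1, inter_comm, card_sdiff_add_card_inter]
  have hVM := card_VV_le M
  have hVM2 : k * #M ≤ k * (2 * k * g + k) + 4 * k ^ 2 * g := by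
    have : k * #M ≤ k * (2 * k * g + k + 4 * k * g) := Nat.mul_le_mul_left _ (by omega)
    nlinarith
  have hBbig : ∀ i, L + 1 ≤ #(B' i) := by
    intro i
    have h1 := H.cardBB i
    have h2 := H.cardX i
    have h3 : #{v ∈ BB g cls F W | cls v = i} ≤ #(B' i) + #(VV M) := by
      refine le_trans (card_le_card ?_) (card_union_le _ _)
      intro v
      simp only [B', mem_union, mem_filter]
      tauto
    omega
  -- sizes
  have hMn : #M < n := by
    have := hAB ⟨0, by omega⟩
    have := hBbig ⟨0, by omega⟩
    omega
  obtain ⟨D, -, hD⟩ := exists_subset_card_eq (s := (univ : Finset (Fin k)))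
    (n := ∑ i, #(B' i) + #M - n + 1) (by simp; omega)
  let m : Fin k → ℕ := fun j => #(B' j) - if j ∈ D then 1 else 0
  have hm : ∀ j, m j + (if j ∈ D then 1 else 0) = #(B' j) := by
    intro j
    have := hBbig j
    simp only [m]
    split_ifs <;> omega
  have hmsum : ∑ j, m j + 1 + #M = n := by
    have h1 : ∑ j, m j + #D = ∑ j, #(B' j) := by
      rw [← sum_congr rfl (fun j _ => hm j), sum_add_distrib]
      simp
    omega
  have hmB : ∀ j, m j ≤ #(B' j) ∧ #(B' j) ≤ m j + 1 := by
    intro j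
    have := hm j
    split_ifs at this <;> omega
  -- tuples
  have hψ : ∀ i : Fin k, ∃ e : {p : (Σ j, Fin (m j)) // ¬ p.1 = i} → α, Function.Injective e ∧
      (∀ p, e p ∈ A' i) ∧ ∀ p, ∀ h : (p.1.2 : ℕ) < L, e p = ρ i (p.1.1, ⟨p.1.2, h⟩) := by
    intro i
    obtain ⟨e, he1, he2, he3⟩ := extend_inj (J := {p : (Σ j, Fin (m j)) // ¬ p.1 = i}) (A' i)
      (by
        rw [Fintype.card_subtype_compl, Fintype.card_congr (Equiv.sigmaSubtype i)]
        simp only [Fintype.card_sigma, Fintype.card_fin]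
        have := hAB i
        have := hmB i
        omega)
      (univ.filter fun p => (p.1.2 : ℕ) < L)
      (fun p => ρ i (p.1.1, ⟨p.1.2 % L, Nat.mod_lt _ (by omega)⟩))
      (by
        intro p hp
        simp only [A', mem_filter, mem_univ, true_and]
        refine ⟨(hρ2 _ _).1, (hρ2 _ _).2, ?_⟩
        intro h
        exact Finset.disjoint_left.1 hMR h (mem_image.2 ⟨(i, _), mem_univ _, rfl⟩))
      (by
        rintro ⟨⟨j, t⟩, hp⟩ h ⟨⟨j', t'⟩, hp'⟩ h' he
        simp only [coe_filter, mem_univ, true_and, Set.mem_ofPred_eq] at h h'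
        have := hρi i he
        simp only [Prod.mk.injEq, Fin.mk.injEq] at this
        obtain ⟨rfl, h3⟩ := this
        rw [Nat.mod_eq_of_lt h, Nat.mod_eq_of_lt h'] at h3
        have : t = t' := Fin.ext h3
        subst this
        rfl)
    refine ⟨e, he1, he2, ?_⟩
    intro p h
    rw [he3 p (by simpa using h)]
    simp only [Nat.mod_eq_of_lt h]
  choose e he1 he2 he3 using hψ
  obtain ⟨a0, ha0⟩ := H.availA ∅ (by simp; omega)
  let ψ : (Σ j, Fin (m j)) → Fin k → α := fun p i =>
    if h : ¬ p.1 = i then e i ⟨p, h⟩ else a0 i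
  have hψA : ∀ p i, ¬ p.1 = i → ψ p i ∈ A' i := by
    intro p i h
    simp only [ψ, h, not_false_eq_true, dite_true]
    exact he2 _ _
  have hψW : ∀ p i, cls (ψ p i) = i ∧ ψ p i ∈ W := by
    intro p i
    by_cases h : p.1 = i
    · simp only [ψ, h, not_true_eq_false, dite_false]
      exact ⟨(ha0 i).1, (ha0 i).2.1⟩
    · have := hψA p i h
      simp only [A', mem_filter, mem_univ, true_and] at this
      exact ⟨this.1, this.2.1⟩
  have hB'W : ∀ j, ∀ b ∈ B' j, cls b = j ∧ b ∉ W := by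
    intro j b hb
    simp only [B', mem_filter] at hb
    exact ⟨hb.2.1, not_W_of_BB hb.1⟩
  -- Hall
  have hall : ∀ j, ∃ h : Fin (m j) → α, Function.Injective h ∧
      ∀ t, h t ∈ (B' j).filter fun b => F (Function.update (ψ ⟨j, t⟩) j b) := by
    intro j
    rw [← Finset.all_card_le_biUnion_card_iff_exists_injective]
    intro s
    rcases s.eq_empty_or_nonempty with rfl | ⟨t0, ht0⟩
    · simp
    by_cases hs : #s + g ≤ #(B' j)
    · have h1 := H.miss (fun i => (hψW ⟨j, t0⟩ i).1) (j := j) (fun i _ => (hψW ⟨j, t0⟩ i).2)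
        (B' j) (hB'W j)
      have h2 := card_filter_add_card_filter_not (s := B' j)
        (fun b => F (Function.update (ψ ⟨j, t0⟩) j b))
      have h3 := card_le_card (subset_biUnion_of_mem
        (fun t => (B' j).filter fun b => F (Function.update (ψ ⟨j, t⟩) j b)) ht0)
      omega
    · refine (card_le_univ s).trans ?_
      rw [Fintype.card_fin]
      refine (hmB j).1.trans (card_le_card ?_)
      intro b hb
      have hb' := hb
      simp only [B', mem_filter] at hb'
      obtain ⟨hbB, rfl, hbM⟩ := hb'
      have hbH : b ∉ Hd := fun h => hbM (hMY (mem_union_right _ h))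
      simp only [Hd, mem_filter, hbB, true_and, not_le] at hbH
      have hLm : L ≤ m (cls b) := by have := hBbig (cls b); have := hmB (cls b); omega
      have hQ : #{t | F (Function.update (T (cls b) t) (cls b) b)} ≤
          #{t | F (Function.update (ψ ⟨cls b, t⟩) (cls b) b)} := by
        apply card_le_card_of_injOn (Fin.castLE hLm)
        · intro t ht
          simp only [coe_filter, mem_univ, true_and, Set.mem_ofPred_eq] at ht ⊢
          convert ht using 1
          ext i
          by_cases hi : i = cls b
          · subst hi; simp
          · have hi' : ¬ cls b = i := fun h => hi h.symm
            simp only [Function.update_of_ne hi, ψ, hi', not_false_eq_true, dite_true, T]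
            rw [he3 i ⟨⟨cls b, Fin.castLE hLm t⟩, hi'⟩ (by simp)]
            rfl
        · intro x _ y _ h
          exact Fin.castLE_injective hLm h
      by_contra hcon
      simp only [mem_biUnion, mem_filter, not_exists, not_and] at hcon
      have hdis : Disjoint s (univ.filter fun t => F (Function.update (ψ ⟨cls b, t⟩) (cls b) b)) := by
        rw [Finset.disjoint_left]
        intro t ht ht'
        simp only [mem_filter, mem_univ, true_and] at ht'
        exact hcon t ht hb ht'
      have h5 := card_le_univ (s ∪ (univ.filter fun t =>
        F (Function.update (ψ ⟨cls b, t⟩) (cls b) b)))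
      rw [card_union_of_disjoint hdis, Fintype.card_fin] at h5
      have := hmB (cls b)
      omega
  choose h hh1 hh2 using hall
  simp only [mem_filter] at hh2
  let E : (Σ j, Fin (m j)) → Fin k → α := fun p => Function.update (ψ p) p.1 (h p.1 p.2)
  have hEself : ∀ p, E p p.1 = h p.1 p.2 := fun p => by simp [E]
  have hEne : ∀ p i, ¬ p.1 = i → E p i = ψ p i := fun p i hi => by
    simp only [E]
    rw [Function.update_of_ne (fun h => hi h.symm)]
  have hEM : ∀ p i, E p i ∉ VV M := by
    intro p i
    by_cases hi : p.1 = i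
    · subst hi
      rw [hEself]
      have := (hh2 p.1 p.2).1
      simp only [B', mem_filter] at this
      exact this.2.2
    · rw [hEne p i hi]
      have := hψA p i hi
      simp only [A', mem_filter] at this
      exact this.2.2.2
  have hEi : ∀ i p q, E p i = E q i → p = q := by
    intro i p q hpq
    by_cases hp : p.1 = i <;> by_cases hq : q.1 = i
    · obtain ⟨j, t⟩ := p
      obtain ⟨j', t'⟩ := q
      simp only at hp hq
      subst hp
      subst hq
      have h1 := hEself ⟨j', t⟩
      have h2 := hEself ⟨j', t'⟩
      simp only at h1 h2
      rw [h1, h2] at hpq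
      rw [hh1 _ hpq]
    · exfalso
      subst hp
      rw [hEself, hEne q _ hq] at hpq
      exact (hB'W _ _ (hh2 p.1 p.2).1).2 (hpq ▸ (hψW q _).2)
    · exfalso
      subst hq
      rw [hEself, hEne p _ hp] at hpq
      exact (hB'W _ _ (hh2 q.1 q.2).1).2 (hpq ▸ (hψW p _).2)
    · rw [hEne p i hp, hEne q i hq] at hpq
      simp only [ψ, hp, hq, not_false_eq_true, dite_true] at hpq
      have := he1 i hpq
      simpa using this
  have hEinj : Function.Injective E := fun p q hpq =>
    hEi ⟨0, by omega⟩ p q (congrFun hpq _)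
  refine ⟨M ∪ univ.image E, ⟨?_, ?_, ?_⟩, ?_⟩
  · intro f hf
    rcases mem_union.1 hf with hf | hf
    · exact hM.tr f hf
    · obtain ⟨p, -, rfl⟩ := mem_image.1 hf
      exact tr_update (fun i => (hψW p i).1) (hB'W _ _ (hh2 p.1 p.2).1).1
  · intro f hf
    rcases mem_union.1 hf with hf | hf
    · exact hM.ed f hf
    · obtain ⟨p, -, rfl⟩ := mem_image.1 hf
      exact (hh2 p.1 p.2).2
  · intro f hf f' hf' i hi
    rcases mem_union.1 hf with hf | hf <;> rcases mem_union.1 hf' with hf' | hf'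
    · exact hM.dj f hf f' hf' i hi
    · obtain ⟨p, -, rfl⟩ := mem_image.1 hf'
      exact absurd (mem_VV.2 ⟨f, hf, i, hi⟩) (hEM p i)
    · obtain ⟨p, -, rfl⟩ := mem_image.1 hf
      exact absurd (mem_VV.2 ⟨f', hf', i, hi.symm⟩) (hEM p i)
    · obtain ⟨p, -, rfl⟩ := mem_image.1 hf
      obtain ⟨q, -, rfl⟩ := mem_image.1 hf'
      rw [hEi i p q hi]
  · rw [card_union_of_disjoint, card_image_of_injective _ hEinj]
    · simp only [card_univ, Fintype.card_sigma, Fintype.card_fin]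
      omega
    · rw [Finset.disjoint_left]
      intro f hf hf'
      obtain ⟨p, -, rfl⟩ := mem_image.1 hf'
      exact hEM p ⟨0, by omega⟩ (mem_VV.2 ⟨_, hf, _, rfl⟩)
end Helpers

/-- extremal case: For k ≥ 3, 0 < γ < ε < 1/(100k³) with
γ(1-1/k-γ)^{k-1} < ε² and ε < (1/k-4kε)^{k-1}/100, and n large: if H is a k-partite
k-graph with classes of size n, δ_{k-1}(H) ≥ n/k, and H contains an independent set
with at least (1-γ)(k-1)n/k vertices in each class, then ν(H) ≥ n - 1. -/
theorem stmt11 (k : ℕ) (hk : 3 ≤ k) (γ ε : ℝ) (hγ0 : 0 < γ) (hγε : γ < ε)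
    (hε : ε < 1 / (100 * (k : ℝ)^3))
    (h1 : γ * (1 - 1 / (k : ℝ) - γ)^(k - 1) < ε^2)
    (h2 : ε < (1 / (k : ℝ) - 4 * k * ε)^(k - 1) / 100) :
    ∃ n0 : ℕ, ∀ n : ℕ, n0 ≤ n →
    ∀ (α : Type) [Fintype α] [DecidableEq α],
    ∀ P : Fin k → Finset α,
    (∀ v : α, ∃! i, v ∈ P i) →
    (∀ i, (P i).card = n) →
    ∀ E : Finset (Finset α),
    (∀ e ∈ E, ∀ i, (e ∩ P i).card = 1) →
    (∀ S : Finset α, S.card = k - 1 → (∀ i, (S ∩ P i).card ≤ 1) →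
      (n : ℝ) / k ≤ ((Finset.univ.filter (fun v => insert v S ∈ E)).card : ℝ)) →
    (∃ W : Finset α, (∀ e ∈ E, ¬ e ⊆ W) ∧
      ∀ i, (1 - γ) * ((k : ℝ) - 1) * n / k ≤ ((W ∩ P i).card : ℝ)) →
    ∃ M ⊆ E, (∀ a ∈ M, ∀ b ∈ M, a ≠ b → Disjoint a b) ∧ n - 1 ≤ M.card := by
  classical
  refine ⟨100 * k ^ 3, ?_⟩
  intro n hn α _ _ P hP hPc E hE hdeg ⟨W, hW, hWc⟩
  choose cls hcls hcls2 using hP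
  have hmem : ∀ v i, v ∈ P i ↔ cls v = i := by
    intro v i
    constructor
    · intro h; exact (hcls2 v i h).symm
    · rintro rfl; exact hcls v
  have hk0 : (0 : ℝ) < k := by exact_mod_cast (by omega : 0 < k)
  have hk3 : (3 : ℝ) ≤ k := by exact_mod_cast hk
  have hPf : ∀ i, (Finset.univ.filter fun v => cls v = i) = P i := by
    intro i; ext v; simp [hmem]
  have hg0 : (0 : ℝ) ≤ γ * n := by positivity
  have hγ1 : 100 * (k : ℝ) ^ 3 * γ ≤ 1 := by
    have := hγε.trans hε
    rw [lt_div_iff₀ (by positivity)] at this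
    linarith
  have hnk : (0 : ℝ) ≤ (n : ℝ) / k := by positivity
  have H : HS k n ⌈(n : ℝ) / k⌉₊ ⌊γ * n⌋₊ cls (fun f => Finset.univ.image f ∈ E) W := by
    constructor
    · exact hk
    · exact hn
    · have h := Nat.floor_le hg0
      have : (100 * (k : ℝ) ^ 3 * (⌊γ * n⌋₊ : ℝ)) ≤ n := by
        calc (100 * (k : ℝ) ^ 3 * (⌊γ * n⌋₊ : ℝ)) ≤ 100 * (k : ℝ) ^ 3 * (γ * n) := by gcongr
          _ = (100 * (k : ℝ) ^ 3 * γ) * n := by ring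
          _ ≤ 1 * n := by gcongr
          _ = n := one_mul _
      exact_mod_cast this
    · have h := Nat.le_ceil ((n : ℝ) / k)
      rw [div_le_iff₀ hk0] at h
      have : n ≤ ⌈(n : ℝ) / k⌉₊ * k := by exact_mod_cast h
      linarith
    · have h := (Nat.ceil_lt_add_one hnk).le
      have h2 : (k : ℝ) * ⌈(n : ℝ) / k⌉₊ ≤ k * ((n : ℝ) / k + 1) := by gcongr
      have h3 : (k : ℝ) * ((n : ℝ) / k + 1) = n + k := by field_simp
      rw [h3] at h2
      exact_mod_cast h2
    · intro i
      rw [hPf, hPc]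
    · intro f hf j
      have hinj : Function.Injective f := by
        intro a b h
        rw [← hf a, h, hf b]
      have h := hdeg ((Finset.univ.erase j).image f) (by
        rw [Finset.card_image_of_injective _ hinj]
        simp) (by
        intro i
        rw [Finset.card_le_one]
        intro a ha b hb
        simp only [Finset.mem_inter, Finset.mem_image, hmem] at ha hb
        obtain ⟨⟨x, -, rfl⟩, hx⟩ := ha
        obtain ⟨⟨y, -, rfl⟩, hy⟩ := hb
        rw [hf] at hx hy
        rw [hx, hy])
      refine (Nat.ceil_le.2 h).trans (Finset.card_le_card ?_)
      intro v hv
      simp only [Finset.mem_filter, Finset.mem_univ, true_and] at hv ⊢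
      have h1 := hE _ hv j
      have hvj : cls v = j := by
        obtain ⟨w, hw⟩ := Finset.card_eq_one.1 h1
        have hw' : w ∈ insert v ((Finset.univ.erase j).image f) ∩ P j := by
          rw [hw]; simp
        simp only [Finset.mem_inter, Finset.mem_insert, Finset.mem_image, hmem,
          Finset.mem_erase, Finset.mem_univ, and_true] at hw'
        obtain ⟨rfl | ⟨x, hx, rfl⟩, h2⟩ := hw'
        · exact h2
        · rw [hf] at h2; exact absurd h2 hx
      refine ⟨hvj, ?_⟩
      have heq : Finset.univ.image (Function.update f j v) =
          insert v ((Finset.univ.erase j).image f) := by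
        ext w
        simp only [Finset.mem_image, Finset.mem_univ, true_and, Finset.mem_insert,
          Finset.mem_erase, and_true]
        constructor
        · rintro ⟨x, rfl⟩
          by_cases hx : x = j
          · subst hx; left; simp
          · right; exact ⟨x, hx, by simp [hx]⟩
        · rintro (rfl | ⟨x, hx, rfl⟩)
          · exact ⟨j, by simp⟩
          · exact ⟨x, by simp [hx]⟩
      rw [heq]; exact hv
    · intro f hf hF
      by_contra! hcon
      refine hW _ hF ?_
      intro v hv
      obtain ⟨i, -, rfl⟩ := Finset.mem_image.1 hv
      exact hcon i
    · intro i
      have h1 := hWc i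
      have h2 := Finset.card_filter_add_card_filter_not
        (s := Finset.univ.filter fun v => cls v = i) (fun v => v ∈ W)
      rw [Finset.filter_filter, Finset.filter_filter, hPf, hPc] at h2
      have h3 : (Finset.univ.filter fun v => cls v = i ∧ v ∈ W) = W ∩ P i := by
        ext v; simp [hmem, and_comm]
      rw [h3] at h2
      have h4 : ((W ∩ P i).card : ℝ) +
          ((Finset.univ.filter fun v => cls v = i ∧ v ∉ W).card : ℝ) = n := by exact_mod_cast h2
      set c := (Finset.univ.filter fun v => cls v = i ∧ v ∉ W).card with hc
      have h5 : (c : ℝ) ≤ n / k + γ * n := by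
        have h6 : (1 - γ) * ((k : ℝ) - 1) * n / k = n - n / k - γ * n + γ * n / k := by
          field_simp; ring
        have h7 : 0 ≤ γ * n / k := by positivity
        linarith
      have h6 := Nat.le_ceil ((n : ℝ) / k)
      have h7 : c - ⌈(n : ℝ) / k⌉₊ ≤ ⌊γ * n⌋₊ := by
        rcases le_total c ⌈(n : ℝ) / k⌉₊ with h | h
        · rw [Nat.sub_eq_zero_of_le h]; exact Nat.zero_le _
        · apply Nat.le_floor
          rw [Nat.cast_sub h]
          linarith
      omega
  obtain ⟨M, hM, hMc⟩ := H.core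
  have himg : ∀ f ∈ M, ∀ f' ∈ M, ∀ v, v ∈ Finset.univ.image f → v ∈ Finset.univ.image f' →
      f = f' := by
    intro f hf f' hf' v hv hv'
    obtain ⟨i, -, hi⟩ := Finset.mem_image.1 hv
    obtain ⟨j, -, hj⟩ := Finset.mem_image.1 hv'
    have : i = j := by rw [← hM.tr f hf i, ← hM.tr f' hf' j, hi, hj]
    subst this
    exact hM.dj f hf f' hf' i (hi.trans hj.symm)
  refine ⟨M.image fun f => Finset.univ.image f, ?_, ?_, ?_⟩
  · intro e he
    obtain ⟨f, hf, rfl⟩ := Finset.mem_image.1 he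
    exact hM.ed f hf
  · intro a ha b hb hab
    obtain ⟨f, hf, rfl⟩ := Finset.mem_image.1 ha
    obtain ⟨f', hf', rfl⟩ := Finset.mem_image.1 hb
    rw [Finset.disjoint_left]
    intro v hv hv'
    exact hab (by rw [himg f hf f' hf' v hv hv'])
  · rw [Finset.card_image_of_injOn]
    · exact hMc
    · intro f hf f' hf' hff
      have h0 : f ⟨0, by omega⟩ ∈ Finset.univ.image f := Finset.mem_image_of_mem _ (Finset.mem_univ _)
      have hff' : Finset.univ.image f = Finset.univ.image f' := hff
      exact himg f hf f' hf' _ h0 (hff' ▸ h0)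
end
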